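/- Let d be a Dyck path on an n×n board of the form (d_1, n−2, …, n−2, n−1, …, n−1, n, …, n) (i.e., d_i ∈ {n−2, n−1, n} for all i ≥ 2) with bounce number 3, let P = P(d) and G = inc(P). Then the chromatic quasisymmetric function X_G(x,q) is e-positive: there exist polynomials c_λ(q) ∈ ℕ[q], indexed by partitions λ of n, such that for every N ≥ n, X_G(x_1,…,x_N;q) = Σ_{λ ⊢ n} c_λ(q) · e_{λ_1}(x_1,…,x_N) ⋯ e_{λ_ℓ}(x_1,…,x_N). -/

import Mathlib

open scoped Classical

/-- A Dyck path on an `n × n` board: a weakly increasing sequence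
`d 1 ≤ d 2 ≤ ⋯ ≤ d (n-1) ≤ n` with `i ≤ d i`; we record it on indices `1, …, n`
with the harmless boundary convention `d n = n`. -/
structure DyckPath (n : ℕ) where
  d : ℕ → ℕ
  mono : ∀ i j : ℕ, 1 ≤ i → i ≤ j → j ≤ n → d i ≤ d j
  le_n : ∀ i : ℕ, 1 ≤ i → i ≤ n → d i ≤ n
  ge_self : ∀ i : ℕ, 1 ≤ i → i ≤ n → i ≤ d i
  top : d n = n

namespace DyckPath

variable {n : ℕ}

/-- The natural unit interval order `P(d)`: `i ≺ j ↔ i < n ∧ j > d i`. -/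
def prec (D : DyckPath n) (i j : ℕ) : Prop := i < n ∧ D.d i < j

/-- Incomparability in `P(d)`; distinct incomparable vertices are the edges of `inc(P)`. -/
def Incomp (D : DyckPath n) (x y : ℕ) : Prop := ¬ D.prec x y ∧ ¬ D.prec y x

/-- The bounce sequence `m 0 = d 1`, `m (k+1) = d (m k + 1)`. -/
def bounce (D : DyckPath n) : ℕ → ℕ
  | 0 => D.d 1
  | k + 1 => D.d (D.bounce k + 1)

def m0 (D : DyckPath n) : ℕ := D.bounce 0

def m1 (D : DyckPath n) : ℕ := D.bounce 1

/-- `d` has bounce number three: `m 2 = n` is the first bounce term equal to `n`. -/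
def BounceThree (D : DyckPath n) : Prop := D.m0 < n ∧ D.m1 < n ∧ D.bounce 2 = n

/-- A proper coloring of `inc(P(d))` with colors in `Fin N`
(vertex `v : Fin n` stands for `v + 1 ∈ {1, …, n}`). -/
def IsProperColoring (D : DyckPath n) {N : ℕ} (κ : Fin n → Fin N) : Prop :=
  ∀ u v : Fin n, D.Incomp (u.1 + 1) (v.1 + 1) → u ≠ v → κ u ≠ κ v

/-- The number of ascents of a coloring: edges `{i, j}` of `inc(P(d))` with `i < j`
and `κ i < κ j`. -/
noncomputable def ascNum (D : DyckPath n) {N : ℕ} (κ : Fin n → Fin N) : ℕ :=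
  (Finset.univ.filter fun p : Fin n × Fin n =>
    p.1 < p.2 ∧ D.Incomp (p.1.1 + 1) (p.2.1 + 1) ∧ κ p.1 < κ p.2).card

/-- The chromatic quasisymmetric polynomial `X_{inc(P(d))}(x₁, …, x_N; q)`, as a
multivariate polynomial in `x₁, …, x_N` with coefficients in `ℤ[q]`. -/
noncomputable def Xq (D : DyckPath n) (N : ℕ) : MvPolynomial (Fin N) (Polynomial ℤ) :=
  ∑ κ ∈ (Finset.univ : Finset (Fin n → Fin N)).filter (fun κ => D.IsProperColoring κ),
    MvPolynomial.C ((Polynomial.X : Polynomial ℤ) ^ D.ascNum κ) *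
      ∏ v : Fin n, MvPolynomial.X (κ v)

end DyckPath

namespace ChromaticQuasi

section Coloring

variable {F : Type*} [Field F] {N : ℕ}

/-- The weight of an edge whose smaller and larger endpoints have colors `s` and `t`. -/
noncomputable def edgeWt (q : F) (s t : Fin N) : F := if s < t then q else if s = t then 0 else 1

/-- The weighted sum over colorings for the ordered edge set `E`. -/
noncomputable def chiE (q : F) (x : Fin N → F) {n : ℕ} (E : Finset (Fin n × Fin n)) : F :=
  ∑ κ : Fin n → Fin N, (∏ e ∈ E, edgeWt q (κ e.1) (κ e.2)) * ∏ v, x (κ v)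

/-- The edge set in which `u < v` are adjacent exactly when `β v ≤ u`. -/
noncomputable def edgeSet (n : ℕ) (β : ℕ → ℕ) : Finset (Fin n × Fin n) :=
  Finset.univ.filter fun e => e.1 < e.2 ∧ β e.2.1 ≤ e.1.1

/-- The chromatic quasisymmetric polynomial of the graph with edge set `edgeSet n β`. -/
noncomputable def chi (q : F) (x : Fin N → F) (n : ℕ) (β : ℕ → ℕ) : F := chiE q x (edgeSet n β)

theorem edgeSet_congr {n : ℕ} {β γ : ℕ → ℕ}
    (h : ∀ u v, u < v → v < n → (β v ≤ u ↔ γ v ≤ u)) : edgeSet n β = edgeSet n γ := by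
  ext ⟨u, v⟩
  simp only [edgeSet, Finset.mem_filter, Finset.mem_univ, true_and]
  exact and_congr_right fun huv => h u.1 v.1 huv v.2

theorem chi_congr (q : F) (x : Fin N → F) {n : ℕ} {β γ : ℕ → ℕ}
    (h : ∀ u v, u < v → v < n → (β v ≤ u ↔ γ v ≤ u)) : chi q x n β = chi q x n γ := by
  rw [chi, chi, edgeSet_congr h]

theorem sum_eq_zero_of_add_comp [CharZero F] {α : Type*} [Fintype α] (σ : Equiv.Perm α) (f : α → F)
    (h : ∀ a, f a + f (σ a) = 0) : ∑ a, f a = 0 := by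
  have h1 : ∑ a, (f a + f (σ a)) = 0 := Finset.sum_eq_zero fun a _ => h a
  rw [Finset.sum_add_distrib, Equiv.sum_comp σ f] at h1
  exact add_self_eq_zero.mp h1

theorem edgeWt_of_lt (q : F) {s t : Fin N} (h : s < t) : edgeWt q s t = q := if_pos h

theorem edgeWt_self (q : F) (s : Fin N) : edgeWt q s s = 0 := by simp [edgeWt]

theorem edgeWt_of_gt (q : F) {s t : Fin N} (h : t < s) : edgeWt q s t = 1 := by
  simp [edgeWt, h.not_gt, h.ne']

theorem edgeWt_modular_above (q : F) (s t y : Fin N) :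
    ((1 + q) * (edgeWt q s t * edgeWt q t y) - q * edgeWt q s t
        - edgeWt q s t * (edgeWt q s y * edgeWt q t y))
      + ((1 + q) * (edgeWt q t s * edgeWt q s y) - q * edgeWt q t s
        - edgeWt q t s * (edgeWt q t y * edgeWt q s y)) = 0 := by
  rcases lt_trichotomy s t with h | h | h <;> rcases lt_trichotomy s y with h' | h' | h' <;>
    rcases lt_trichotomy t y with h'' | h'' | h'' <;>
    first
    | (exfalso; omega)
    | (try subst h
       try subst h'
       try subst h''
       simp [edgeWt_of_lt, edgeWt_self, edgeWt_of_gt, *]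
       try ring)

theorem edgeWt_modular_below (q : F) (s t y : Fin N) :
    ((1 + q) * (edgeWt q s t * edgeWt q y s) - q * edgeWt q s t
        - edgeWt q s t * (edgeWt q y s * edgeWt q y t))
      + ((1 + q) * (edgeWt q t s * edgeWt q y t) - q * edgeWt q t s
        - edgeWt q t s * (edgeWt q y t * edgeWt q y s)) = 0 := by
  rcases lt_trichotomy s t with h | h | h <;> rcases lt_trichotomy s y with h' | h' | h' <;>
    rcases lt_trichotomy t y with h'' | h'' | h'' <;>
    first
    | (exfalso; omega)
    | (try subst h
       try subst h'
       try subst h''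
       simp [edgeWt_of_lt, edgeWt_self, edgeWt_of_gt, *]
       try ring)

theorem prod_edgeWt_comp_swap (q : F) {n : ℕ} {u v : Fin n} {R : Finset (Fin n × Fin n)}
    (hR : ∀ e ∈ R, (Equiv.swap u v e.1, Equiv.swap u v e.2) ∈ R) (κ : Fin n → Fin N) :
    ∏ e ∈ R, edgeWt q (κ (Equiv.swap u v e.1)) (κ (Equiv.swap u v e.2))
      = ∏ e ∈ R, edgeWt q (κ e.1) (κ e.2) :=
  Finset.prod_nbij' (fun e => (Equiv.swap u v e.1, Equiv.swap u v e.2))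
    (fun e => (Equiv.swap u v e.1, Equiv.swap u v e.2)) hR hR (by simp) (by simp) (by simp)

theorem chiE_modular_above [CharZero F] (q : F) (x : Fin N → F) {n : ℕ} {u v z : Fin n}
    {R : Finset (Fin n × Fin n)} (huv : u ≠ v) (huz : u ≠ z) (hvz : v ≠ z)
    (hR : ∀ e ∈ R, (Equiv.swap u v e.1, Equiv.swap u v e.2) ∈ R)
    (h1 : (u, v) ∉ R) (h2 : (v, z) ∉ R) (h3 : (u, z) ∉ R) :
    (1 + q) * chiE q x (insert (u, v) (insert (v, z) R))
      = q * chiE q x (insert (u, v) R)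
        + chiE q x (insert (u, v) (insert (u, z) (insert (v, z) R))) := by
  rw [← sub_eq_zero]
  unfold chiE
  rw [Finset.mul_sum, Finset.mul_sum, ← Finset.sum_add_distrib, ← Finset.sum_sub_distrib]
  refine sum_eq_zero_of_add_comp (Equiv.arrowCongr (Equiv.swap u v) (Equiv.refl _)) _ fun κ => ?_
  have e1 : ∀ i, (Equiv.arrowCongr (Equiv.swap u v) (Equiv.refl (Fin N))) κ i
      = κ (Equiv.swap u v i) := fun i => rfl
  have hx : ∏ i, x (κ (Equiv.swap u v i)) = ∏ i, x (κ i) :=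
    Equiv.prod_comp (Equiv.swap u v) fun i => x (κ i)
  have hz : Equiv.swap u v z = z := Equiv.swap_apply_of_ne_of_ne huz.symm hvz.symm
  simp only [e1]
  rw [Finset.prod_insert (by simp [*]), Finset.prod_insert (by simp [*]),
    Finset.prod_insert (by simp [*]), Finset.prod_insert (by simp [*]),
    Finset.prod_insert (by simp [*]), Finset.prod_insert (by simp [*]),
    Finset.prod_insert (by simp [*]), Finset.prod_insert (by simp [*]),
    Finset.prod_insert (by simp [*]), Finset.prod_insert (by simp [*]),
    Finset.prod_insert (by simp [*]), Finset.prod_insert (by simp [*]),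
    prod_edgeWt_comp_swap q hR, hx]
  simp only [Equiv.swap_apply_left, Equiv.swap_apply_right, hz]
  linear_combination (∏ e ∈ R, edgeWt q (κ e.1) (κ e.2)) * (∏ i, x (κ i)) *
    edgeWt_modular_above q (κ u) (κ v) (κ z)

theorem chiE_modular_below [CharZero F] (q : F) (x : Fin N → F) {n : ℕ} {u v z : Fin n}
    {R : Finset (Fin n × Fin n)} (huv : u ≠ v) (huz : u ≠ z) (hvz : v ≠ z)
    (hR : ∀ e ∈ R, (Equiv.swap u v e.1, Equiv.swap u v e.2) ∈ R)
    (h1 : (u, v) ∉ R) (h2 : (z, u) ∉ R) (h3 : (z, v) ∉ R) :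
    (1 + q) * chiE q x (insert (u, v) (insert (z, u) R))
      = q * chiE q x (insert (u, v) R)
        + chiE q x (insert (u, v) (insert (z, v) (insert (z, u) R))) := by
  rw [← sub_eq_zero]
  unfold chiE
  rw [Finset.mul_sum, Finset.mul_sum, ← Finset.sum_add_distrib, ← Finset.sum_sub_distrib]
  refine sum_eq_zero_of_add_comp (Equiv.arrowCongr (Equiv.swap u v) (Equiv.refl _)) _ fun κ => ?_
  have e1 : ∀ i, (Equiv.arrowCongr (Equiv.swap u v) (Equiv.refl (Fin N))) κ i
      = κ (Equiv.swap u v i) := fun i => rfl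
  have hx : ∏ i, x (κ (Equiv.swap u v i)) = ∏ i, x (κ i) :=
    Equiv.prod_comp (Equiv.swap u v) fun i => x (κ i)
  have hz : Equiv.swap u v z = z := Equiv.swap_apply_of_ne_of_ne huz.symm hvz.symm
  have huv' := huv.symm
  simp only [e1]
  rw [Finset.prod_insert (by simp [*]), Finset.prod_insert (by simp [*]),
    Finset.prod_insert (by simp [*]), Finset.prod_insert (by simp [*]),
    Finset.prod_insert (by simp [*]), Finset.prod_insert (by simp [*]),
    Finset.prod_insert (by simp [*]), Finset.prod_insert (by simp [*]),
    Finset.prod_insert (by simp [*]), Finset.prod_insert (by simp [*]),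
    Finset.prod_insert (by simp [*]), Finset.prod_insert (by simp [*]),
    prod_edgeWt_comp_swap q hR, hx]
  simp only [Equiv.swap_apply_left, Equiv.swap_apply_right, hz]
  linear_combination (∏ e ∈ R, edgeWt q (κ e.1) (κ e.2)) * (∏ i, x (κ i)) *
    edgeWt_modular_below q (κ u) (κ v) (κ z)

end Coloring

section Moves

variable {F : Type*} [Field F] {N : ℕ}

theorem mem_edgeSet {n : ℕ} {β : ℕ → ℕ} {e : Fin n × Fin n} :
    e ∈ edgeSet n β ↔ e.1.1 < e.2.1 ∧ β e.2.1 ≤ e.1.1 := by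
  rw [edgeSet, Finset.mem_filter]
  exact ⟨fun h => h.2, fun h => ⟨Finset.mem_univ _, h⟩⟩

theorem swap_mem_erase_edgeSet {n u : ℕ} {β : ℕ → ℕ} (hu : u + 1 < n) (hsame : β u = β (u + 1))
    (hw : ∀ w, u + 1 < w → w < n → β w ≠ u + 1) (e : Fin n × Fin n)
    (he : e ∈ (edgeSet n β).erase (⟨u, by omega⟩, ⟨u + 1, hu⟩)) :
    (Equiv.swap (⟨u, by omega⟩ : Fin n) ⟨u + 1, hu⟩ e.1,
        Equiv.swap (⟨u, by omega⟩ : Fin n) ⟨u + 1, hu⟩ e.2)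
      ∈ (edgeSet n β).erase (⟨u, by omega⟩, ⟨u + 1, hu⟩) := by
  obtain ⟨⟨i, hi⟩, ⟨j, hj⟩⟩ := e
  have hwj := hw j
  simp only [Finset.mem_erase, mem_edgeSet, Equiv.swap_apply_def, ne_eq, Prod.mk.injEq,
    Fin.mk.injEq] at he ⊢
  rcases eq_or_ne i u with rfl | h1
  · rcases eq_or_ne j (i + 1) with rfl | h2
    · omega
    · have h3 : j ≠ i := by omega
      simp [h2, h3]
      omega
  · rcases eq_or_ne i (u + 1) with rfl | h2
    · have h3 : j ≠ u := by omega
      have h4 : j ≠ u + 1 := by omega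
      simp [h3, h4]
      omega
    · rcases eq_or_ne j u with rfl | h3
      · simp [h1, h2]
        omega
      · rcases eq_or_ne j (u + 1) with rfl | h4
        · simp [h1, h2]
          omega
        · simp [h1, h2, h3, h4]
          omega

theorem chi_column [CharZero F] (q : F) (x : Fin N → F) {n z k : ℕ} {β β₀ β₂ : ℕ → ℕ}
    (hz : z < n) (hk : 1 ≤ k) (hkz : k + 1 ≤ z) (hadj : β k + 1 ≤ k) (hsame : β (k - 1) = β k)
    (hw : ∀ w, k < w → w < n → w ≠ z → β w ≠ k)
    (h1 : β z = k) (h0 : β₀ z = k + 1) (h2 : β₂ z = k - 1)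
    (h0' : ∀ w, w < n → w ≠ z → β₀ w = β w) (h2' : ∀ w, w < n → w ≠ z → β₂ w = β w) :
    (1 + q) * chi q x n β = q * chi q x n β₀ + chi q x n β₂ := by
  obtain ⟨u, rfl⟩ : ∃ u, k = u + 1 := ⟨k - 1, by omega⟩
  simp only [Nat.add_sub_cancel] at hsame h2
  let U : Fin n := ⟨u, by omega⟩
  let V : Fin n := ⟨u + 1, by omega⟩
  let Z : Fin n := ⟨z, hz⟩
  let R := (edgeSet n β₀).erase (U, V)
  have hUV : U ≠ V := by simp [U, V]
  have hUZ : U ≠ Z := by simp only [U, Z, ne_eq, Fin.mk.injEq]; omega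
  have hVZ : V ≠ Z := by simp only [V, Z, ne_eq, Fin.mk.injEq]; omega
  have h0k := h0' (u + 1) (by omega) (by omega)
  have h0k' := h0' u (by omega) (by omega)
  have hmem : ∀ i j : Fin n, (i, j) ∈ R ↔ ¬ (i.1 = u ∧ j.1 = u + 1) ∧ i.1 < j.1 ∧ β₀ j.1 ≤ i.1 := by
    intro i j
    simp [R, mem_edgeSet, U, V, Fin.ext_iff]
  have e0 : edgeSet n β₀ = insert (U, V) R := by
    ext ⟨i, j⟩
    rw [Finset.mem_insert, hmem, mem_edgeSet]
    simp only [Prod.mk.injEq, U, V, Fin.ext_iff]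
    grind
  have e1 : edgeSet n β = insert (U, V) (insert (V, Z) R) := by
    ext ⟨i, j⟩
    rw [Finset.mem_insert, Finset.mem_insert, hmem, mem_edgeSet]
    simp only [Prod.mk.injEq, U, V, Z, Fin.ext_iff]
    have := h0' j.1 j.2
    grind
  have e2 : edgeSet n β₂ = insert (U, V) (insert (U, Z) (insert (V, Z) R)) := by
    ext ⟨i, j⟩
    rw [Finset.mem_insert, Finset.mem_insert, Finset.mem_insert, hmem, mem_edgeSet]
    simp only [Prod.mk.injEq, U, V, Z, Fin.ext_iff]
    have := h0' j.1 j.2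
    have := h2' j.1 j.2
    grind
  rw [chi, chi, chi, e0, e1, e2]
  refine chiE_modular_above q x hUV hUZ hVZ
    (swap_mem_erase_edgeSet (by omega) (by omega) fun w h1 h2 => ?_) ?_ ?_ ?_
  · by_cases h : w = z
    · rw [h]; omega
    · rw [h0' w h2 h]; exact hw w h1 h2 h
  all_goals
    rw [hmem]
    dsimp only [U, V, Z]
    omega

theorem chi_row [CharZero F] (q : F) (x : Fin N → F) {n z u : ℕ} {β β₀ β₂ : ℕ → ℕ}
    (hu : u + 1 < n) (hz : z < u)
    (hw : ∀ w, u + 1 < w → w < n → β w ≠ u + 1)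
    (h1 : β u = z) (h1' : β (u + 1) = z + 1) (h0 : β₀ u = z + 1) (h0' : β₀ (u + 1) = z + 1)
    (h2 : β₂ u = z) (h2' : β₂ (u + 1) = z)
    (h0r : ∀ w, w < n → w ≠ u → w ≠ u + 1 → β₀ w = β w)
    (h2r : ∀ w, w < n → w ≠ u → w ≠ u + 1 → β₂ w = β w) :
    (1 + q) * chi q x n β = q * chi q x n β₀ + chi q x n β₂ := by
  let U : Fin n := ⟨u, by omega⟩
  let V : Fin n := ⟨u + 1, by omega⟩
  let Z : Fin n := ⟨z, by omega⟩
  let R := (edgeSet n β₀).erase (U, V)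
  have hUV : U ≠ V := by simp [U, V]
  have hUZ : U ≠ Z := by simp only [U, Z, ne_eq, Fin.mk.injEq]; omega
  have hVZ : V ≠ Z := by simp only [V, Z, ne_eq, Fin.mk.injEq]; omega
  have hmem : ∀ i j : Fin n, (i, j) ∈ R ↔ ¬ (i.1 = u ∧ j.1 = u + 1) ∧ i.1 < j.1 ∧ β₀ j.1 ≤ i.1 := by
    intro i j
    simp [R, mem_edgeSet, U, V, Fin.ext_iff]
  have e0 : edgeSet n β₀ = insert (U, V) R := by
    ext ⟨i, j⟩
    rw [Finset.mem_insert, hmem, mem_edgeSet]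
    simp only [Prod.mk.injEq, U, V, Fin.ext_iff]
    grind
  have e1 : edgeSet n β = insert (U, V) (insert (Z, U) R) := by
    ext ⟨i, j⟩
    rw [Finset.mem_insert, Finset.mem_insert, hmem, mem_edgeSet]
    simp only [Prod.mk.injEq, U, V, Z, Fin.ext_iff]
    have := h0r j.1 j.2
    grind
  have e2 : edgeSet n β₂ = insert (U, V) (insert (Z, V) (insert (Z, U) R)) := by
    ext ⟨i, j⟩
    rw [Finset.mem_insert, Finset.mem_insert, Finset.mem_insert, hmem, mem_edgeSet]
    simp only [Prod.mk.injEq, U, V, Z, Fin.ext_iff]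
    have := h0r j.1 j.2
    have := h2r j.1 j.2
    grind
  rw [chi, chi, chi, e0, e1, e2]
  refine chiE_modular_below q x hUV hUZ hVZ
    (swap_mem_erase_edgeSet (by omega) (by omega) fun w h1 h2 => ?_) ?_ ?_ ?_
  · rw [h0r w h2 (by omega) (by omega)]
    exact hw w h1 h2
  all_goals
    rw [hmem]
    dsimp only [U, V, Z]
    omega

end Moves

section Products

variable {F : Type*} [Field F] {N : ℕ}

theorem chi_eq_sum (q : F) (x : Fin N → F) (n : ℕ) (β : ℕ → ℕ) :
    chi q x n β = ∑ κ : Fin n → Fin N,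
      (∏ i : Fin n, ∏ j : Fin n, if i.1 < j.1 ∧ β j.1 ≤ i.1 then edgeWt q (κ i) (κ j) else 1)
        * ∏ v, x (κ v) := by
  refine Finset.sum_congr rfl fun κ _ => ?_
  rw [edgeSet, Finset.prod_filter, ← Finset.univ_product_univ, Finset.prod_product]
  rfl

theorem chi_add (q : F) (x : Fin N → F) (m k : ℕ) (β : ℕ → ℕ)
    (h : ∀ v, m ≤ v → v < m + k → m ≤ β v) :
    chi q x (m + k) β = chi q x m β * chi q x k fun v => β (m + v) - m := by
  rw [chi_eq_sum, chi_eq_sum, chi_eq_sum, Finset.sum_mul_sum, ← Finset.sum_product',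
    Finset.univ_product_univ, ← (Fin.appendEquiv m k).sum_comp]
  refine Finset.sum_congr rfl fun κ _ => ?_
  have hv : ∀ j : Fin k, m ≤ β (m + j) := fun j => h _ (by omega) (by omega)
  have h1 : ∀ (i : Fin m) (j : Fin k), ¬ (i.1 < m + j.1 ∧ β (m + j.1) ≤ i.1) := by
    intro i j
    have := hv j
    omega
  have h2 : ∀ (i : Fin k) (j : Fin m), ¬ (m + i.1 < j.1 ∧ β j.1 ≤ m + i.1) := by
    intro i j
    omega
  have h3 : ∀ i j : Fin k, (m + i.1 < m + j.1 ∧ β (m + j.1) ≤ m + i.1)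
      ↔ (i.1 < j.1 ∧ β (m + j.1) - m ≤ i.1) := by
    intro i j
    omega
  simp only [Fin.appendEquiv, Equiv.coe_fn_mk, Fin.prod_univ_add, Fin.append_left,
    Fin.append_right, Fin.val_castAdd, Fin.val_natAdd, h1, h2, h3, if_false,
    Finset.prod_const_one, mul_one, one_mul]
  ring

/-- The elementary symmetric polynomial of degree `k` evaluated at `x`. -/
noncomputable def elem (x : Fin N → F) (k : ℕ) : F :=
  ∑ S ∈ (Finset.univ : Finset (Fin N)).powersetCard k, ∏ i ∈ S, x i

/-- The `q`-integer `[k]`. -/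
noncomputable def br (q : F) (k : ℕ) : F := ∑ i ∈ Finset.range k, q ^ i

/-- The `q`-factorial `[k]!`. -/
noncomputable def fac (q : F) (k : ℕ) : F := ∏ i ∈ Finset.range k, br q (i + 1)

theorem sum_pow_card_lt (q : F) (S : Finset (Fin N)) :
    ∑ c ∈ S, q ^ (S.filter (· < c)).card = br q S.card := by
  induction S using Finset.induction_on_max with
  | empty => simp [br]
  | insert a S ha ih =>
    have hn : a ∉ S := fun h => lt_irrefl _ (ha a h)
    rw [Finset.sum_insert hn, Finset.card_insert_of_notMem hn, br, Finset.sum_range_succ, ← br,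
      ← ih, add_comm]
    congr 1
    · refine Finset.sum_congr rfl fun c hc => ?_
      rw [Finset.filter_insert, if_neg (ha c hc).not_gt]
    · rw [Finset.filter_insert, if_neg (lt_irrefl a), Finset.filter_true_of_mem ha]

/-- The product of all edge weights of the complete graph. -/
noncomputable def cliqueWt (q : F) {n : ℕ} (κ : Fin n → Fin N) : F :=
  ∏ i : Fin n, ∏ j : Fin n, if i.1 < j.1 then edgeWt q (κ i) (κ j) else 1

theorem cliqueWt_eq_zero (q : F) {n : ℕ} {κ : Fin n → Fin N} (h : ¬ Function.Injective κ) :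
    cliqueWt q κ = 0 := by
  simp only [Function.Injective, not_forall] at h
  obtain ⟨i, j, hij, hne⟩ := h
  wlog hlt : i.1 < j.1 generalizing i j
  · exact this j i hij.symm (Ne.symm hne) (by omega)
  · refine Finset.prod_eq_zero (Finset.mem_univ i) (Finset.prod_eq_zero (Finset.mem_univ j) ?_)
    rw [if_pos hlt, hij, edgeWt_self]

theorem cliqueWt_snoc (q : F) {n : ℕ} (κ : Fin n → Fin N) (c : Fin N) :
    cliqueWt q (Fin.snoc κ c : Fin (n + 1) → Fin N) = cliqueWt q κ * ∏ i, edgeWt q (κ i) c := by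
  have h : ∀ i : Fin n, ¬ Fin.last n < i.castSucc := fun i => (Fin.castSucc_lt_last i).not_gt
  simp [cliqueWt, Fin.prod_univ_castSucc, Finset.prod_mul_distrib, h]

theorem sum_cliqueWt (q : F) (n : ℕ) (S : Finset (Fin N)) (hS : S.card = n) :
    ∑ κ ∈ Fintype.piFinset fun _ : Fin n => S, cliqueWt q κ = fac q n := by
  induction n generalizing S with
  | zero => simp [cliqueWt, fac]
  | succ n ih =>
    have key : ∀ c ∈ S, ∑ κ ∈ Fintype.piFinset fun _ : Fin n => S,
        cliqueWt q (Fin.snoc κ c : Fin (n + 1) → Fin N)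
          = q ^ (S.filter (· < c)).card * fac q n := by
      intro c hc
      rw [← ih (S.erase c) (by rw [Finset.card_erase_of_mem hc, hS]; rfl), Finset.mul_sum]
      symm
      have hsub : (Fintype.piFinset fun _ : Fin n => S.erase c) ⊆ Fintype.piFinset fun _ => S :=
        Fintype.piFinset_subset _ _ fun _ => Finset.erase_subset _ _
      refine Eq.trans (Finset.sum_congr rfl fun κ hκ => ?_)
        (Finset.sum_subset hsub fun κ hκ hκ' => ?_)
      · rw [cliqueWt_snoc, mul_comm]
        by_cases hinj : Function.Injective κ
        · congr 1
          have himg : Finset.univ.image κ = S.erase c := by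
            refine Finset.eq_of_subset_of_card_le ?_ ?_
            · intro a ha
              obtain ⟨i, -, rfl⟩ := Finset.mem_image.mp ha
              exact Fintype.mem_piFinset.mp hκ i
            · rw [Finset.card_image_of_injective _ hinj, Finset.card_erase_of_mem hc, hS]
              simp
          have h1 : ∏ i, edgeWt q (κ i) c = ∏ s ∈ S.erase c, edgeWt q s c := by
            rw [← himg, Finset.prod_image fun i _ j _ h => hinj h]
          have h2 : S.filter (· < c) = (S.erase c).filter (· < c) := by
            ext s
            simp only [Finset.mem_filter, Finset.mem_erase]
            exact ⟨fun h => ⟨⟨h.2.ne, h.1⟩, h.2⟩, fun h => ⟨h.1.2, h.2⟩⟩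
          rw [h1, h2, Finset.card_eq_sum_ones, ← Finset.prod_pow_eq_pow_sum, Finset.prod_filter]
          refine Finset.prod_congr rfl fun s hs => ?_
          have := Finset.ne_of_mem_erase hs
          simp [edgeWt, this]
        · rw [cliqueWt_eq_zero q hinj, zero_mul, zero_mul]
      · rw [cliqueWt_snoc]
        have : ∃ i, κ i = c := by
          by_contra! hne
          exact hκ' (Fintype.mem_piFinset.mpr fun i =>
            Finset.mem_erase.mpr ⟨hne i, Fintype.mem_piFinset.mp hκ i⟩)
        obtain ⟨i, hi⟩ := this
        rw [Finset.prod_eq_zero (Finset.mem_univ i) (by rw [hi, edgeWt_self]), mul_zero]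
    have hsplit : ∑ κ ∈ Fintype.piFinset fun _ : Fin (n + 1) => S, cliqueWt q κ
        = ∑ c ∈ S, ∑ κ ∈ Fintype.piFinset fun _ : Fin n => S,
          cliqueWt q (Fin.snoc κ c : Fin (n + 1) → Fin N) := by
      rw [← Finset.sum_product']
      refine Finset.sum_nbij' (fun κ => (κ (Fin.last n), Fin.init κ))
        (fun p => Fin.snoc p.2 p.1) ?_ ?_ ?_ ?_ ?_
      · intro κ hκ
        rw [Fintype.mem_piFinset] at hκ
        simp only [Finset.mem_product, Fintype.mem_piFinset]
        exact ⟨hκ _, fun i => hκ _⟩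
      · intro p hp
        simp only [Finset.mem_product, Fintype.mem_piFinset] at hp ⊢
        intro i
        refine Fin.lastCases ?_ (fun j => ?_) i
        · simpa using hp.1
        · simpa using hp.2 j
      · intro κ _
        simp
      · intro p _
        simp
      · intro κ _
        simp
    rw [hsplit, Finset.sum_congr rfl key, ← Finset.sum_mul, sum_pow_card_lt, hS, fac, fac,
      Finset.prod_range_succ, mul_comm]

theorem chi_clique (q : F) (x : Fin N → F) (n : ℕ) (β : ℕ → ℕ) (h : ∀ v, v < n → β v = 0) :
    chi q x n β = fac q n * elem x n := by
  have h1 : chi q x n β = ∑ κ : Fin n → Fin N, cliqueWt q κ * ∏ v, x (κ v) := by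
    rw [chi_eq_sum]
    refine Finset.sum_congr rfl fun κ _ => ?_
    simp [cliqueWt, h]
  have h2 : ∑ κ : Fin n → Fin N, cliqueWt q κ * ∏ v, x (κ v)
      = ∑ κ ∈ Finset.univ.filter fun κ : Fin n → Fin N => Function.Injective κ,
          cliqueWt q κ * ∏ v, x (κ v) := by
    rw [Finset.sum_filter]
    refine Finset.sum_congr rfl fun κ _ => ?_
    split_ifs with hκ
    · rfl
    · rw [cliqueWt_eq_zero q hκ, zero_mul]
  rw [h1, h2, elem, Finset.mul_sum]
  rw [← Finset.sum_fiberwise_of_maps_to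
    (t := (Finset.univ : Finset (Fin N)).powersetCard n) (g := fun κ => Finset.univ.image κ)]
  · refine Finset.sum_congr rfl fun S hS => ?_
    rw [Finset.mem_powersetCard_univ] at hS
    rw [← sum_cliqueWt q n S hS, Finset.sum_mul, Finset.filter_filter]
    have hsub : (Finset.univ.filter fun κ : Fin n → Fin N =>
        Function.Injective κ ∧ Finset.univ.image κ = S) ⊆ Fintype.piFinset fun _ => S := by
      intro κ hκ
      simp only [Finset.mem_filter, Finset.mem_univ, true_and] at hκ
      rw [Fintype.mem_piFinset]
      intro i
      rw [← hκ.2]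
      exact Finset.mem_image_of_mem _ (Finset.mem_univ i)
    refine Eq.trans (Finset.sum_congr rfl fun κ hκ => ?_) (Finset.sum_subset hsub fun κ hκ hκ' => ?_)
    · simp only [Finset.mem_filter, Finset.mem_univ, true_and] at hκ
      rw [← hκ.2, Finset.prod_image fun i _ j _ h => hκ.1 h]
    · rw [cliqueWt_eq_zero, zero_mul]
      intro hinj
      refine hκ' ?_
      simp only [Finset.mem_filter, Finset.mem_univ, true_and]
      refine ⟨hinj, Finset.eq_of_subset_of_card_le ?_ ?_⟩
      · intro a ha
        obtain ⟨i, -, rfl⟩ := Finset.mem_image.mp ha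
        exact Fintype.mem_piFinset.mp hκ i
      · rw [Finset.card_image_of_injective _ hinj, hS]
        simp
  · intro κ hκ
    simp only [Finset.mem_filter, Finset.mem_univ, true_and] at hκ
    rw [Finset.mem_powersetCard_univ, Finset.card_image_of_injective _ hκ]
    simp

end Products

section Thresholds

variable {F : Type*} [Field F] {N : ℕ}

/-- Thresholds of the family with three nontrivial columns and rows: vertex `0` is adjacent
exactly to the vertices below `c`, and the last two vertices have thresholds `a` and `b`. -/
def hookThreshold (n c a b v : ℕ) : ℕ :=
  if v + 1 = n then b else if v + 2 = n then a else if v < c then 0 else 1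

/-- The chromatic quasisymmetric polynomial of `hookThreshold n c a b`. -/
noncomputable def hookX (q : F) (x : Fin N → F) (n c a b : ℕ) : F :=
  chi q x n (hookThreshold n c a b)

theorem hookX_move_left [CharZero F] (q : F) (x : Fin N → F) {n c a b : ℕ} (ha : 1 ≤ a) (han : a + 3 ≤ n)
    (hac : a ≠ c) (hab : a ≠ b) (h : 2 ≤ a ∨ n ≤ c + 2) :
    (1 + q) * hookX q x n c a b = q * hookX q x n c (a + 1) b + hookX q x n c (a - 1) b := by
  refine chi_column q x (z := n - 2) (k := a) ?_ ?_ ?_ ?_ ?_ ?_ ?_ ?_ ?_ ?_ ?_ <;>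
    intros <;> (try simp only [hookThreshold]) <;> (repeat' split_ifs) <;> omega

theorem hookX_move_right [CharZero F] (q : F) (x : Fin N → F) {n c a b : ℕ} (hb : 1 ≤ b) (hbn : b + 3 ≤ n)
    (hbc : b ≠ c) (hab : a < b) (h : 2 ≤ b ∨ n ≤ c + 2) :
    (1 + q) * hookX q x n c a b = q * hookX q x n c a (b + 1) + hookX q x n c a (b - 1) := by
  refine chi_column q x (z := n - 1) (k := b) ?_ ?_ ?_ ?_ ?_ ?_ ?_ ?_ ?_ ?_ ?_ <;>
    intros <;> (try simp only [hookThreshold]) <;> (repeat' split_ifs) <;> omega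

theorem hookX_move_right_one [CharZero F] (q : F) (x : Fin N → F) {n c : ℕ} (hn : 4 ≤ n) (hc : c + 3 ≤ n) :
    (1 + q) * hookX q x n c 1 (n - 2)
      = q * hookX q x n c 1 (n - 1) + hookX q x n c 1 (n - 3) := by
  refine chi_column q x (z := n - 1) (k := n - 2) ?_ ?_ ?_ ?_ ?_ ?_ ?_ ?_ ?_ ?_ ?_ <;>
    intros <;> (try simp only [hookThreshold]) <;> (repeat' split_ifs) <;> omega

theorem hookX_move_top [CharZero F] (q : F) (x : Fin N → F) {n c a b : ℕ} (hc : 2 ≤ c) (hcn : c + 3 ≤ n)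
    (hac : a ≠ c) (hbc : b ≠ c) :
    (1 + q) * hookX q x n c a b = q * hookX q x n (c - 1) a b + hookX q x n (c + 1) a b := by
  refine chi_row q x (u := c - 1) (z := 0) ?_ ?_ ?_ ?_ ?_ ?_ ?_ ?_ ?_ ?_ ?_ <;>
    intros <;> (try simp only [hookThreshold]) <;> (repeat' split_ifs) <;> omega

theorem hookX_move_diag [CharZero F] (q : F) (x : Fin N → F) {n c a : ℕ} (han : a + 3 ≤ n) :
    (1 + q) * hookX q x n c a (a + 1)
      = q * hookX q x n c (a + 1) (a + 1) + hookX q x n c a a := by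
  refine chi_row q x (u := n - 2) (z := a) ?_ ?_ ?_ ?_ ?_ ?_ ?_ ?_ ?_ ?_ ?_ <;>
    intros <;> (try simp only [hookThreshold]) <;> (repeat' split_ifs) <;> omega

/-- A complete graph with `b` edges removed at the last vertex. -/
noncomputable def colX (q : F) (x : Fin N → F) (m b : ℕ) : F :=
  chi q x m fun v => if v + 1 = m then b else 0

/-- A complete graph with edges removed at the first vertex. -/
noncomputable def rowX (q : F) (x : Fin N → F) (m c : ℕ) : F :=
  chi q x m fun v => if v < c then 0 else 1

/-- The complete graph. -/
noncomputable def fullX (q : F) (x : Fin N → F) (m : ℕ) : F := fac q m * elem x m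

theorem colX_move [CharZero F] (q : F) (x : Fin N → F) {m b : ℕ} (hb : 1 ≤ b) (hbm : b + 2 ≤ m) :
    (1 + q) * colX q x m b = q * colX q x m (b + 1) + colX q x m (b - 1) := by
  refine chi_column q x (z := m - 1) (k := b) ?_ ?_ ?_ ?_ ?_ ?_ ?_ ?_ ?_ ?_ ?_ <;>
    intros <;> (repeat' split_ifs) <;> omega

theorem rowX_move [CharZero F] (q : F) (x : Fin N → F) {m c : ℕ} (hc : 2 ≤ c) (hcm : c + 1 ≤ m) :
    (1 + q) * rowX q x m c = q * rowX q x m (c - 1) + rowX q x m (c + 1) := by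
  refine chi_row q x (u := c - 1) (z := 0) ?_ ?_ ?_ ?_ ?_ ?_ ?_ ?_ ?_ ?_ ?_ <;>
    intros <;> (repeat' split_ifs) <;> omega

theorem colX_zero (q : F) (x : Fin N → F) (m : ℕ) : colX q x m 0 = fullX q x m :=
  chi_clique q x m _ fun v _ => by simp

theorem rowX_self (q : F) (x : Fin N → F) (m : ℕ) : rowX q x m m = fullX q x m :=
  chi_clique q x m _ fun v hv => by simp [hv]

theorem fullX_one (q : F) (x : Fin N → F) : fullX q x 1 = elem x 1 := by
  simp [fullX, fac, br]

/-- Splitting off a factor on the first `m` vertices. -/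
theorem chi_split (q : F) (x : Fin N → F) (m k : ℕ) {β γ δ : ℕ → ℕ}
    (h : ∀ v, m ≤ v → v < m + k → m ≤ β v)
    (hγ : ∀ u v, u < v → v < m → (β v ≤ u ↔ γ v ≤ u))
    (hδ : ∀ u v, u < v → v < k → (β (m + v) ≤ m + u ↔ δ v ≤ u)) :
    chi q x (m + k) β = chi q x m γ * chi q x k δ := by
  rw [chi_add q x m k β h, chi_congr q x hγ]
  congr 1
  refine chi_congr q x fun u v huv hv => ?_
  rw [← hδ u v huv hv]
  omega

theorem colX_last (q : F) (x : Fin N → F) (m : ℕ) :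
    colX q x (m + 1) m = fullX q x m * elem x 1 := by
  rw [← fullX_one q x, fullX, ← chi_clique q x m (fun _ => 0) fun _ _ => rfl,
    fullX, ← chi_clique q x 1 (fun _ => 0) fun _ _ => rfl]
  refine chi_split q x m 1 ?_ ?_ ?_ <;> intros <;> (try split_ifs) <;> omega

theorem rowX_one (q : F) (x : Fin N → F) (m : ℕ) :
    rowX q x (m + 1) 1 = elem x 1 * fullX q x m := by
  rw [← fullX_one q x, fullX, ← chi_clique q x 1 (fun _ => 0) fun _ _ => rfl,
    fullX, ← chi_clique q x m (fun _ => 0) fun _ _ => rfl, add_comm m, rowX]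
  refine chi_split q x 1 m ?_ ?_ ?_ <;> intros <;> (try split_ifs) <;> omega

theorem hookX_one_left (q : F) (x : Fin N → F) {n a b : ℕ} (hn : 3 ≤ n) :
    hookX q x (n + 1) 1 (a + 1) (b + 1) = elem x 1 * hookX q x n (n - 2) a b := by
  rw [← fullX_one q x, fullX, ← chi_clique q x 1 (fun _ => 0) fun _ _ => rfl, add_comm n, hookX]
  refine chi_split q x 1 n ?_ ?_ ?_ <;> intros <;> (try simp only [hookThreshold]) <;>
    (repeat' split_ifs) <;> omega

theorem hookX_last_right (q : F) (x : Fin N → F) {n c : ℕ} (hc : c + 2 ≤ n) :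
    hookX q x (n + 1) c 1 n = rowX q x n c * elem x 1 := by
  rw [← fullX_one q x, fullX, ← chi_clique q x 1 (fun _ => 0) fun _ _ => rfl, hookX]
  refine chi_split q x n 1 ?_ ?_ ?_ <;> intros <;> (try simp only [hookThreshold]) <;>
    (repeat' split_ifs) <;> omega

theorem hookX_last_right' (q : F) (x : Fin N → F) {n c a : ℕ} (hc : c + 2 ≤ n) :
    hookX q x (n + 1) c a n = hookX q x n c 1 a * elem x 1 := by
  rw [← fullX_one q x, fullX, ← chi_clique q x 1 (fun _ => 0) fun _ _ => rfl, hookX]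
  refine chi_split q x n 1 ?_ ?_ ?_ <;> intros <;> (try simp only [hookThreshold]) <;>
    (repeat' split_ifs) <;> omega

theorem hookX_last_right_full (q : F) (x : Fin N → F) {n a : ℕ} (hn : 2 ≤ n) :
    hookX q x (n + 1) (n - 1) a n = colX q x n a * elem x 1 := by
  rw [← fullX_one q x, fullX, ← chi_clique q x 1 (fun _ => 0) fun _ _ => rfl, hookX]
  refine chi_split q x n 1 ?_ ?_ ?_ <;> intros <;> (try simp only [hookThreshold]) <;>
    (repeat' split_ifs) <;> omega

theorem hookX_split_two (q : F) (x : Fin N → F) {n c : ℕ} (hc : c ≤ n) :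
    hookX q x (n + 2) c n n = rowX q x n c * fullX q x 2 := by
  rw [fullX, ← chi_clique q x 2 (fun _ => 0) fun _ _ => rfl, hookX]
  refine chi_split q x n 2 ?_ ?_ ?_ <;> intros <;> (try simp only [hookThreshold]) <;>
    (repeat' split_ifs) <;> omega

end Thresholds

section Affine

variable {F : Type*} [Field F]

theorem br_mul (q : F) (k : ℕ) : br q k * (q - 1) = q ^ k - 1 := geom_sum_mul q k

theorem eq_add_br {q : F} {g : ℕ → F} {lo L : ℕ}
    (h : ∀ i, lo < i → i < lo + L → (1 + q) * g i = q * g (i - 1) + g (i + 1)) :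
    ∀ i, i ≤ L → g (lo + i) = g lo + (g (lo + 1) - g lo) * br q i := by
  have hd : ∀ i, i + 1 ≤ L → g (lo + i + 1) - g (lo + i) = (g (lo + 1) - g lo) * q ^ i := by
    intro i
    induction i with
    | zero => intro _; simp
    | succ i ih =>
      intro hi
      have h1 := h (lo + i + 1) (by omega) (by omega)
      have h2 := ih (by omega)
      rw [Nat.add_sub_cancel] at h1
      rw [pow_succ, ← add_assoc]
      linear_combination q * h2 - h1
  intro i
  induction i with
  | zero => intro _; simp [br]
  | succ i ih =>
    intro hi
    have h1 := hd i hi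
    have h2 := ih (by omega)
    rw [br, Finset.sum_range_succ, ← br, ← add_assoc]
    linear_combination h1 + h2

/-- Interpolation for sequences affine in `q ^ i`. -/
theorem interpolate_asc {q : F} {g : ℕ → F} (lo s t : ℕ)
    (h : ∀ i, lo < i → i < lo + s + t → (1 + q) * g i = q * g (i - 1) + g (i + 1)) :
    (q ^ s * q ^ t - 1) * g (lo + s)
      = (q ^ s * q ^ t - q ^ s) * g lo + (q ^ s - 1) * g (lo + s + t) := by
  have h' := eq_add_br (L := s + t) (lo := lo) (g := g) (q := q)
    fun i h1 h2 => h i h1 (by omega)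
  have e1 := h' s (by omega)
  have e2 := h' (s + t) le_rfl
  rw [← add_assoc] at e2
  rw [← pow_add, e1, e2, ← br_mul, ← br_mul]
  have e3 : q ^ (s + t) - q ^ s = br q (s + t) * (q - 1) - br q s * (q - 1) := by
    rw [br_mul, br_mul]; ring
  rw [e3]
  ring

/-- Interpolation for sequences affine in `q ^ (-i)`. -/
theorem interpolate_desc {q : F} {g : ℕ → F} (lo s t : ℕ)
    (h : ∀ i, lo < i → i < lo + s + t → (1 + q) * g i = q * g (i + 1) + g (i - 1)) :
    (q ^ s * q ^ t - 1) * g (lo + s)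
      = (q ^ t - 1) * g lo + (q ^ s * q ^ t - q ^ t) * g (lo + s + t) := by
  have := interpolate_asc (q := q) (g := fun i => g (lo + s + t - i)) 0 t s fun i h1 h2 => by
    have h3 := h (lo + s + t - i) (by omega) (by omega)
    rwa [show lo + s + t - (i - 1) = lo + s + t - i + 1 by omega,
      show lo + s + t - (i + 1) = lo + s + t - i - 1 by omega]
  simp only [zero_add, Nat.sub_zero] at this
  rw [show lo + s + t - t = lo + s by omega, show lo + s + t - (t + s) = lo by omega] at this
  linear_combination this

end Affine

/-- The `q`-integer `[k]` as a function of `P = q ^ k`. -/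
def qn {F : Type*} [Field F] (q P : F) : F := (P - 1) / (q - 1)

section Algebra

variable {F : Type*} [Field F]

/-- The closed form for two free columns. -/
def colsF (q J K S E0 E1 E2 : F) : F :=
  qn q (J * K * S * q ^ 2) * qn q (J * K * S / q) * qn q (K * S) * qn q (S * q) * E0
  + qn q (J * K * S) * (S * q * qn q K * qn q (J * K * S / q)
      + K * S * qn q S * (1 + q) * qn q J) * E1
  + K * S ^ 2 * qn q J * (1 + q) * qn q (J * K / q) * E2

/-- The closed form for one row and one column whose cells are disjoint. -/
def hookLowF (q P T K E0 E1 E2 E3 : F) : F :=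
  qn q (P * T * K * q ^ 2) * qn q (P * T * K / q) * qn q P * qn q T * E0
  + (qn q P * qn q (P * T * K * q) * (qn q (P * T * K / q) - qn q T)
      + qn q T * qn q (P * T * K / q) * (qn q (P * T * K * q) - qn q P)) * E1
  + (1 + q) * (P * T * K / q) * qn q P * qn q T * E2
  + qn q (P * T * K / q) * (P * T) * qn q K * E3

/-- The closed form for one row and one column whose ranges overlap. -/
def hookHighF (q I J K E0 E1 E2 : F) : F :=
  qn q (I * J * K * q ^ 2) * qn q (I * J * K / q) * qn q (I * J) * qn q (J * K) * E0
  + qn q (I * J * K) * (J * K * qn q (I * J) * qn q I + I * J * qn q K ^ 2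
      + I * J * K / q * qn q J * qn q (K * q) - I * J * K / q) * E1
  + (1 + q) * (I * J ^ 2 * K / q) * qn q I * qn q K * E2

/-- The coefficient of `e_{n-1} e_1`. -/
def hookCoeff (q M P Y Z : F) : F :=
  Y * qn q (M / q) * (qn q (M * q ^ 2) - P)
  + q * Z * (Y * qn q (M / q) * (qn q (M * q ^ 2) - P)
      + P * qn q (M * q ^ 2) * (qn q (M / q) - Y))

/-- The closed form when `c ≤ a ≤ b`. -/
def hookAF (q P J K S E0 E1 E2 E3 E4 E5 : F) : F :=
  qn q (P * J * K * S / q ^ 2) *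
      (qn q (P * J * K * S * q ^ 3) * qn q (P * J * K * S / q) * qn q P * qn q (K * S)
          * qn q (S * q) * E0
      + (hookCoeff q (P * J * K * S) (qn q P) (qn q (K * S)) (qn q S)
          + q * qn q P * qn q (P * J * K * S * q ^ 2) *
            (qn q (K * S) * qn q (P * J * K * S / q ^ 2) - qn q S * qn q (K * S / q))) * E1
      + qn q (P * J * K * S) * (S * P * q * qn q K * qn q (J * K * S / q)
          + K * S * P * qn q S * (1 + q) * qn q J) * E3
      + (P * K * S ^ 2 * qn q J * (1 + q) * qn q (P * J * K / q)
          + qn q P * (S * P * J * K * S) * qn q K) * E5)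
  + (1 + q) * qn q (P * J * K * S / q) * qn q P *
      (K * S * (qn q (P * J * q) - qn q S) * qn q (P * J * K * S / q ^ 2)
        + P * J * K * S / q * qn q (q ^ 3) * qn q S * qn q (K * S / q)) * E2
  + qn q P * qn q (q ^ 3) * (S * (P * J * K * S / q) * qn q K * qn q (P * J * K * S / q ^ 2)
        + qn q S * (1 + q) * (P * J * K * S / q ^ 2 * (K * S)) * qn q (P * J / q)) * E4

/-- The closed form when `a ≤ c < b`. -/
def hookBF (q I J K S E0 E1 E2 E3 E4 E5 : F) : F :=
  qn q (I * J * K * S / q ^ 2) *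
      (qn q (I * J * K * S * q ^ 3) * qn q (I * J * K * S / q) * qn q (I * J) * qn q (J * K * S)
          * qn q (S * q) * E0
      + (hookCoeff q (I * J * K * S) (qn q (I * J)) (qn q (J * K * S)) (qn q S)
          + q * qn q (I * J) * qn q (I * J * K * S * q ^ 2) *
            (qn q (J * K * S) * qn q (I * J * K * S / q ^ 2) - qn q S * qn q (J * K * S / q))
          + I * J * K * S / q * qn q J * qn q (I * J * K * S * q ^ 2) * qn q (S * q)) * E1
      + qn q (I * J * K * S) * (S * (I * J) * q) * qn q K * qn q (J * K * S / q) * E3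
      + (I * J) * (J * K * S) * S * qn q I * qn q K * E5)
  + (1 + q) * qn q (I * J * K * S / q) *
      ((J * K * S * qn q (I * J) * qn q (I * q)
        + qn q S * (I * J * K * S * q * qn q J - J * qn q I * (K * S)))
          * qn q (I * J * K * S / q ^ 2)
        + qn q S * J * qn q I * (I * J * K * S / q) * qn q (q ^ 3) * qn q (K * S / q)) * E2
  + qn q I * qn q (q ^ 3) * (S * (I * J * K * S / q) * J * qn q K * qn q (I * J * K * S / q ^ 2)
        + qn q S * (1 + q) * (I * J * K * S / q ^ 2 * (J * K * S)) * qn q (I * J / q)) * E4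

end Algebra

section Algebra

variable {F : Type*} [Field F]

/-- The closed form for a single column (or row). -/
def colF (q B T E0 E1 : F) : F := T * qn q B * E1 + qn q T * qn q (B * T * q) * E0

theorem br_eq_qn {q : F} (h1 : q ≠ 1) (k : ℕ) : br q k = qn q (q ^ k) := by
  rw [qn, eq_div_iff (sub_ne_zero.mpr h1), br_mul]

theorem fac_succ (q : F) (m : ℕ) : fac q (m + 1) = fac q m * br q (m + 1) :=
  Finset.prod_range_succ _ _

theorem pow_eq_div {q : F} (h0 : q ≠ 0) {m k : ℕ} {A : F} (h : A = q ^ (m + k)) :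
    q ^ m = A / q ^ k := by
  rw [eq_div_iff (pow_ne_zero _ h0), h, pow_add]

theorem colsF_diag {q : F} (h0 : q ≠ 0) (h1 : q ≠ 1) (J S E0 E1 E2 : F) :
    (1 + q) * ((q - 1) * (qn q (J * S) * qn q (J * S * q) * colF q (J * q) (S * q) E0 E1)
        + (J * q - q) * colsF q (J * q) 1 S E0 E1 E2)
      - q * (J * q - 1) * colsF q (J * q) 1 S E0 E1 E2
      = (J * q - 1) * colsF q J 1 (S * q) E0 E1 E2 := by
  have := sub_ne_zero.mpr h1
  simp only [colsF, colF, qn]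
  field_simp
  ring

theorem colsF_left {q : F} (h0 : q ≠ 0) (h1 : q ≠ 1) (J K S E0 E1 E2 : F) :
    (J * K - 1) * colsF q J K S E0 E1 E2
      = (K - 1) * (qn q (J * K * S / q) * qn q (J * K * S) * colF q (J * K) (S * q) E0 E1)
        + (J * K - K) * colsF q (J * K) 1 S E0 E1 E2 := by
  have := sub_ne_zero.mpr h1
  simp only [colsF, colF, qn]
  field_simp
  ring

end Algebra

variable {F : Type*} [Field F] {N : ℕ}

theorem hookX_zero_left (q : F) (x : Fin N → F) (m b : ℕ) :
    hookX q x (m + 2) m 0 b = colX q x (m + 2) b :=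
  chi_congr q x fun u v huv hv => by
    simp only [hookThreshold]
    split_ifs <;> omega

variable [CharZero F]

theorem colX_eq {q : F} (x : Fin N → F) (h0 : q ≠ 0) (hq : ∀ k, 0 < k → q ^ k ≠ 1)
    {m b t : ℕ} (h : b + t = m + 1) :
    colX q x (m + 2) b
      = fac q m * colF q (q ^ b) (q ^ t) (elem x (m + 2)) (elem x (m + 1) * elem x 1) := by
  have h1 : q ≠ 1 := by simpa using hq 1 one_pos
  have h1' := sub_ne_zero.mpr h1
  have hm := pow_eq_div h0 (show q ^ b * q ^ t = q ^ (m + 1) by rw [← pow_add, h])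
  have key := interpolate_desc (q := q) (g := colX q x (m + 2)) 0 b t
    fun i hi hi' => colX_move q x (by omega) (by omega)
  rw [colX_zero, zero_add, h, colX_last, fullX, fullX, fac_succ, fac_succ,
    br_eq_qn h1, br_eq_qn h1, pow_succ q (m + 1), pow_succ, hm] at key
  have hne : q ^ b * q ^ t - 1 ≠ 0 := by
    rw [← pow_add]; exact sub_ne_zero.mpr (hq _ (by omega))
  refine mul_left_cancel₀ hne (key.trans ?_)
  simp only [colF, qn]
  field_simp
  ring

theorem rowX_eq {q : F} (x : Fin N → F) (h0 : q ≠ 0) (hq : ∀ k, 0 < k → q ^ k ≠ 1)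
    {m p t : ℕ} (h : p + t = m + 1) :
    rowX q x (m + 2) (p + 1)
      = fac q m * colF q (q ^ t) (q ^ p) (elem x (m + 2)) (elem x (m + 1) * elem x 1) := by
  have h1 : q ≠ 1 := by simpa using hq 1 one_pos
  have h1' := sub_ne_zero.mpr h1
  have hm := pow_eq_div h0 (show q ^ p * q ^ t = q ^ (m + 1) by rw [← pow_add, h])
  have key := interpolate_asc (q := q) (g := rowX q x (m + 2)) 1 p t
    fun i hi hi' => rowX_move q x (by omega) (by omega)
  rw [add_assoc, h, add_comm 1 p, add_comm 1, rowX_self, rowX_one, fullX, fullX,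
    fac_succ q (m + 1), fac_succ q m, br_eq_qn h1, br_eq_qn h1, pow_succ q (m + 1), pow_succ, hm] at key
  have hne : q ^ p * q ^ t - 1 ≠ 0 := by
    rw [← pow_add]; exact sub_ne_zero.mpr (hq _ (by omega))
  refine mul_left_cancel₀ hne (key.trans ?_)
  simp only [colF, qn]
  field_simp

theorem colsX_diag_eq {q : F} (x : Fin N → F) (h0 : q ≠ 0) (hq : ∀ k, 0 < k → q ^ k ≠ 1)
    {m : ℕ} (s : ℕ) : ∀ a, a + s = m + 2 →
    hookX q x (m + 4) (m + 2) a a = fac q m * colsF q (q ^ a) 1 (q ^ s) (elem x (m + 4))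
      (elem x (m + 3) * elem x 1) (elem x (m + 2) * elem x 2) := by
  have h1 : q ≠ 1 := by simpa using hq 1 one_pos
  have h1' := sub_ne_zero.mpr h1
  induction s with
  | zero =>
    intro a h
    obtain rfl : a = m + 2 := by omega
    rw [hookX_split_two q x le_rfl, rowX_self, fullX, fullX, fac_succ, fac_succ,
      show fac q 2 = 1 + q by simp [fac, br, Finset.prod_range_succ, Finset.sum_range_succ],
      br_eq_qn h1, br_eq_qn h1]
    simp only [colsF, qn, pow_succ, pow_zero]
    field_simp
    ring
  | succ s ih =>
    intro a h
    have e1 := ih (a + 1) (by omega)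
    have e2 := hookX_move_diag q x (n := m + 4) (c := m + 2) (a := a) (by omega)
    have e3 := interpolate_desc (q := q) (g := fun i => hookX q x (m + 4) (m + 2) i (a + 1)) 0 a 1
      fun i hi hi' => hookX_move_left q x (by omega) (by omega) (by omega) (by omega)
        (Or.inr (by omega))
    have e4 := colX_eq x h0 hq (m := m + 2) (b := a + 1) (t := s + 1) (by omega)
    have hM : q ^ (m + 1) = q ^ a * q ^ s := by rw [← pow_add]; congr 1; omega
    simp only [zero_add, pow_one, hookX_zero_left] at e3
    rw [e4, e1, fac_succ, fac_succ, br_eq_qn h1, br_eq_qn h1, pow_succ q (m + 1), hM,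
      pow_succ, pow_succ] at e3
    rw [e1, pow_succ] at e2
    have hne : q ^ a * q - 1 ≠ 0 := by
      rw [← pow_succ]; exact sub_ne_zero.mpr (hq _ (by omega))
    refine mul_left_cancel₀ hne ?_
    rw [pow_succ]
    have key := colsF_diag h0 h1 (q ^ a) (q ^ s) (elem x (m + 4))
      (elem x (m + 3) * elem x 1) (elem x (m + 2) * elem x 2)
    linear_combination fac q m * key - (q ^ a * q - 1) * e2 + (1 + q) * e3

theorem colsX_eq {q : F} (x : Fin N → F) (h0 : q ≠ 0) (hq : ∀ k, 0 < k → q ^ k ≠ 1)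
    {m j k s : ℕ} (h : j + k + s = m + 2) :
    hookX q x (m + 4) (m + 2) j (j + k) = fac q m * colsF q (q ^ j) (q ^ k) (q ^ s)
      (elem x (m + 4)) (elem x (m + 3) * elem x 1) (elem x (m + 2) * elem x 2) := by
  have h1 : q ≠ 1 := by simpa using hq 1 one_pos
  have e1 := colsX_diag_eq x h0 hq (m := m) s (j + k) h
  rcases Nat.eq_zero_or_pos (j + k) with hz | hpos
  · obtain ⟨rfl, rfl⟩ : j = 0 ∧ k = 0 := by omega
    simpa using e1
  have e3 := interpolate_desc (q := q) (g := fun i => hookX q x (m + 4) (m + 2) i (j + k)) 0 j k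
    fun i hi hi' => hookX_move_left q x (by omega) (by omega) (by omega) (by omega)
      (Or.inr (by omega))
  have e4 := colX_eq x h0 hq (m := m + 2) (b := j + k) (t := s + 1) (by omega)
  have hM : q ^ (m + 2) = q ^ j * q ^ k * q ^ s := by rw [← pow_add, ← pow_add, h]
  have hM' := pow_eq_div h0 hM.symm (m := m + 1) (k := 1)
  simp only [zero_add, hookX_zero_left] at e3
  rw [e4, e1, fac_succ, fac_succ, br_eq_qn h1, br_eq_qn h1, hM, hM', pow_add, pow_one,
    pow_succ q s] at e3
  have hne : q ^ j * q ^ k - 1 ≠ 0 := by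
    rw [← pow_add]; exact sub_ne_zero.mpr (hq _ (by omega))
  refine mul_left_cancel₀ hne ?_
  have key := colsF_left h0 h1 (q ^ j) (q ^ k) (q ^ s) (elem x (m + 4))
    (elem x (m + 3) * elem x 1) (elem x (m + 2) * elem x 2)
  linear_combination e3 - fac q m * key

section Algebra

variable {F : Type*} [Field F]

theorem hookLowF_top {q : F} (h0 : q ≠ 0) (h1 : q ≠ 1) (P K E0 E1 E2 E3 : F) :
    (P * K - 1) * hookLowF q P q K E0 E1 E2 E3
      = (P * K - P) * (qn q (P * K) * colF q (P * K) q E1 E3)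
        + (P - 1) * colsF q q (P * K) 1 E0 E1 E2 := by
  have := sub_ne_zero.mpr h1
  simp only [colsF, colF, hookLowF, qn]
  field_simp
  ring

theorem hookLowF_right {q : F} (h0 : q ≠ 0) (h1 : q ≠ 1) (P K U E0 E1 E2 E3 : F) :
    (U * q - 1) * hookLowF q P q (K * U) E0 E1 E2 E3
      = (q - 1) * hookLowF q P (U * q) K E0 E1 E2 E3
        + (U * q - q) * (qn q (P * K * U) * colF q (K * U * q) P E1 E3) := by
  have := sub_ne_zero.mpr h1
  simp only [colF, hookLowF, qn]
  field_simp
  ring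

theorem hookHighF_right {q : F} (h0 : q ≠ 0) (h1 : q ≠ 1) (I J K E0 E1 E2 E3 : F) :
    (I * J - 1) * hookHighF q I J K E0 E1 E2
      = (J - 1) * (qn q (I * J * K / q) * qn q (I * J * K) * colF q (K * q) (I * J) E0 E1)
        + (I * J - J) * hookLowF q (I * J) K 1 E0 E1 E2 E3 := by
  have := sub_ne_zero.mpr h1
  simp only [colF, hookLowF, hookHighF, qn]
  field_simp
  ring

end Algebra

variable {F : Type*} [Field F] {N : ℕ}

theorem hookX_ones (q : F) (x : Fin N → F) {n c : ℕ} (h : c + 2 ≤ n) :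
    hookX q x n c 1 1 = rowX q x n c :=
  chi_congr q x fun u v huv hv => by
    simp only [hookThreshold]
    split_ifs <;> omega

variable [CharZero F]

theorem hookLow_top_eq {q : F} (x : Fin N → F) (h0 : q ≠ 0) (hq : ∀ k, 0 < k → q ^ k ≠ 1)
    {m p k : ℕ} (h : p + k = m + 1) :
    hookX q x (m + 4) (p + 1) 1 (m + 2) = fac q m * hookLowF q (q ^ p) q (q ^ k)
      (elem x (m + 4)) (elem x (m + 3) * elem x 1) (elem x (m + 2) * elem x 2)
      (elem x (m + 2) * elem x 1 ^ 2) := by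
  have h1 : q ≠ 1 := by simpa using hq 1 one_pos
  have e1 := interpolate_asc (q := q) (g := fun c => hookX q x (m + 4) c 1 (m + 2)) 1 p k
    fun i hi hi' => hookX_move_top q x (by omega) (by omega) (by omega) (by omega)
  have e2 := hookX_one_left q x (n := m + 3) (a := 0) (b := m + 1) (by omega)
  have e3 := colX_eq x h0 hq (m := m + 1) (b := m + 1) (t := 1) (by omega)
  have e4 := colsX_eq x h0 hq (m := m) (j := 1) (k := m + 1) (s := 0) (by omega)
  have hM : q ^ (m + 1) = q ^ p * q ^ k := by rw [← pow_add, h]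
  rw [show 1 + (m + 1) = m + 2 by omega] at e4
  simp only [zero_add, show m + 3 - 2 = m + 1 by omega, hookX_zero_left,
    e3] at e2
  rw [show 1 + p + k = m + 2 by omega, add_comm 1 p, e2, e4] at e1
  rw [fac_succ, br_eq_qn h1, hM] at e1
  simp only [pow_zero, pow_one] at e1
  have hne : q ^ p * q ^ k - 1 ≠ 0 := by
    rw [← pow_add]; exact sub_ne_zero.mpr (hq _ (by omega))
  refine mul_left_cancel₀ hne ?_
  have key := hookLowF_top h0 h1 (q ^ p) (q ^ k) (elem x (m + 4)) (elem x (m + 3) * elem x 1)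
    (elem x (m + 2) * elem x 2) (elem x (m + 2) * elem x 1 ^ 2)
  simp only [colF, show m + 1 + 2 = m + 3 by omega, show m + 1 + 1 = m + 2 by omega]
    at e1 key ⊢
  linear_combination e1 - fac q m * key

theorem hookLow_eq {q : F} (x : Fin N → F) (h0 : q ≠ 0) (hq : ∀ k, 0 < k → q ^ k ≠ 1)
    {m p k t : ℕ} (h : p + k + t = m + 2) (ht : 1 ≤ t) :
    hookX q x (m + 4) (p + 1) 1 (p + 1 + k) = fac q m * hookLowF q (q ^ p) (q ^ t) (q ^ k)
      (elem x (m + 4)) (elem x (m + 3) * elem x 1) (elem x (m + 2) * elem x 2)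
      (elem x (m + 2) * elem x 1 ^ 2) := by
  have h1 : q ≠ 1 := by simpa using hq 1 one_pos
  rcases Nat.lt_or_ge 1 t with ht2 | ht1
  · obtain ⟨u, rfl⟩ : ∃ u, t = u + 2 := ⟨t - 2, by omega⟩
    have e1 := interpolate_desc (q := q) (g := fun b => hookX q x (m + 4) (p + 1) 1 b)
      (p + 1 + k) (u + 1) 1 fun i hi hi' => by
        rcases Nat.lt_or_ge i (m + 2) with hi2 | hi2
        · exact hookX_move_right q x (by omega) (by omega) (by omega) (by omega)
            (Or.inl (by omega))
        · obtain rfl : i = m + 2 := by omega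
          exact hookX_move_right_one q x (by omega) (by omega)
    have e2 := hookLow_top_eq x h0 hq (m := m) (p := p) (k := k + (u + 1)) (by omega)
    have e3 := hookX_last_right q x (n := m + 3) (c := p + 1) (by omega)
    have e4 := rowX_eq x h0 hq (m := m + 1) (p := p) (t := k + (u + 1) + 1) (by omega)
    rw [e4] at e3
    have hM : q ^ (m + 1) = q ^ p * q ^ k * q ^ (u + 1) := by
      rw [← pow_add, ← pow_add]; congr 1; omega
    simp only [show p + 1 + k + (u + 1) = m + 2 by omega, show m + 2 + 1 = m + 3 by omega] at e1
    rw [e2, e3, fac_succ, br_eq_qn h1, hM, pow_one, pow_succ q (k + (u + 1)), pow_add q k] at e1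
    have hne : q - 1 ≠ 0 := sub_ne_zero.mpr h1
    refine mul_left_cancel₀ hne ?_
    have key := hookLowF_right h0 h1 (q ^ p) (q ^ k) (q ^ (u + 1)) (elem x (m + 4))
      (elem x (m + 3) * elem x 1) (elem x (m + 2) * elem x 2) (elem x (m + 2) * elem x 1 ^ 2)
    rw [show u + 2 = u + 1 + 1 by omega, pow_succ q (u + 1)]
    simp only [colF, show m + 1 + 2 = m + 3 by omega, show m + 1 + 1 = m + 2 by omega] at e1 key ⊢
    linear_combination fac q m * key - e1
  · obtain rfl : t = 1 := by omega
    rw [pow_one, ← hookLow_top_eq x h0 hq (m := m) (p := p) (k := k) (by omega)]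
    congr 1
    omega

theorem hookHigh_eq {q : F} (x : Fin N → F) (h0 : q ≠ 0) (hq : ∀ k, 0 < k → q ^ k ≠ 1)
    {m i j k : ℕ} (h : i + j + k = m + 2) (hk : 1 ≤ k) (hij : 1 ≤ i + j) :
    hookX q x (m + 4) (i + j + 1) 1 (i + 1) = fac q m * hookHighF q (q ^ i) (q ^ j) (q ^ k)
      (elem x (m + 4)) (elem x (m + 3) * elem x 1) (elem x (m + 2) * elem x 2) := by
  have h1 : q ≠ 1 := by simpa using hq 1 one_pos
  have e1 := interpolate_desc (q := q) (g := fun b => hookX q x (m + 4) (i + j + 1) 1 b)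
    1 i j fun b hi hi' => hookX_move_right q x (by omega) (by omega) (by omega) (by omega)
      (Or.inl (by omega))
  have e2 := hookX_ones q x (n := m + 4) (c := i + j + 1) (by omega)
  have e3 := rowX_eq x h0 hq (m := m + 2) (p := i + j) (t := k + 1) (by omega)
  have e4 := hookLow_eq x h0 hq (m := m) (p := i + j) (k := 0) (t := k) (by omega) hk
  have hM : q ^ (m + 2) = q ^ i * q ^ j * q ^ k := by rw [← pow_add, ← pow_add, h]
  have hM' := pow_eq_div h0 hM.symm (m := m + 1) (k := 1)
  simp only [add_comm 1 i, show i + 1 + j = i + j + 1 by omega] at e1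
  rw [e2, e3] at e1
  simp only [add_zero, pow_zero] at e4
  rw [e4, fac_succ, fac_succ, br_eq_qn h1, br_eq_qn h1, hM, hM', pow_one,
    pow_succ q k, pow_add q i j] at e1
  have hne : q ^ i * q ^ j - 1 ≠ 0 := by
    rw [← pow_add]; exact sub_ne_zero.mpr (hq _ (by omega))
  refine mul_left_cancel₀ hne ?_
  have key := hookHighF_right h0 h1 (q ^ i) (q ^ j) (q ^ k) (elem x (m + 4))
    (elem x (m + 3) * elem x 1) (elem x (m + 2) * elem x 2) (elem x (m + 2) * elem x 1 ^ 2)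
  linear_combination e1 - fac q m * key

section Algebra

variable {F : Type*} [Field F]

/-- The closed form for `c = a = n - 3`, `b = n - 2`, where `M = q ^ (n - 3)`. -/
def cornerF (q M E0 E1 E2 E4 E5 : F) : F :=
  qn q (M * q ^ 3) * qn q (M / q) ^ 2 * E0
  + (qn q (M / q) * (qn q (M * q ^ 2) - qn q (M / q))
      + q * qn q (M / q) * qn q (M * q ^ 2) * qn q (M / q ^ 2)) * E1
  + (1 + q) * qn q (M / q) ^ 2 * q * qn q M * E2
  + qn q (M / q) * qn q (q ^ 3) * (M / q) * E4
  + qn q (M / q) * M * E5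

theorem cornerF_interp {q : F} (h0 : q ≠ 0) (h1 : q ≠ 1) (M E0 E1 E2 E4 E5 : F) :
    (M - 1) * cornerF q M E0 E1 E2 E4 E5
      = (M / q - 1) * (qn q (M / q) * colsF q M q 1 E0 E1 E2)
        + (M - M / q) * (qn q (M / q) * qn q M * colF q q q E4 E5) := by
  have := sub_ne_zero.mpr h1
  simp only [cornerF, colsF, colF, qn]
  field_simp
  ring

theorem hookAF_corner {q : F} (h0 : q ≠ 0) (h1 : q ≠ 1) (P E0 E1 E2 E3 E4 E5 : F) :
    hookAF q P 1 q 1 E0 E1 E2 E3 E4 E5 = qn q (P / q) * cornerF q (P * q) E0 E1 E2 E4 E5 := by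
  have := sub_ne_zero.mpr h1
  simp only [hookAF, hookCoeff, cornerF, qn]
  field_simp
  ring

theorem hookAF_one {q : F} (h0 : q ≠ 0) (h1 : q ≠ 1) (J K S E0 E1 E2 E3 E4 E5 : F) :
    hookAF q 1 J K S E0 E1 E2 E3 E4 E5 = qn q (J * K * S / q ^ 2) * colsF q J K S E1 E3 E5 := by
  have := sub_ne_zero.mpr h1
  simp only [hookAF, hookCoeff, colsF, qn]
  field_simp
  ring

theorem hookAF_two {q : F} (h0 : q ≠ 0) (h1 : q ≠ 1) (P J E0 E1 E2 E3 E4 E5 : F) :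
    hookAF q P J 1 1 E0 E1 E2 E3 E4 E5
      = qn q (P * J / q ^ 2) * qn q (P * J / q) * (1 + q) * colF q J P E2 E5 := by
  have := sub_ne_zero.mpr h1
  simp only [hookAF, hookCoeff, colF, qn]
  field_simp
  ring

theorem hookAF_row {q : F} (h0 : q ≠ 0) (h1 : q ≠ 1) (P J K S E0 E1 E2 E3 E4 E5 : F) :
    (P * J - 1) * hookAF q P J K S E0 E1 E2 E3 E4 E5
      = (P * J - P) * hookAF q 1 (P * J) K S E0 E1 E2 E3 E4 E5
        + (P - 1) * hookAF q (P * J) 1 K S E0 E1 E2 E3 E4 E5 := by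
  have := sub_ne_zero.mpr h1
  simp only [hookAF, hookCoeff, qn]
  field_simp
  ring

theorem hookAF_row_second {q : F} (h0 : q ≠ 0) (h1 : q ≠ 1) (P J K S E0 E1 E2 E3 E4 E5 : F) :
    (P - 1) * hookAF q q (P * J / q) K S E0 E1 E2 E3 E4 E5
      = (P - q) * hookAF q 1 (P * J) K S E0 E1 E2 E3 E4 E5
        + (q - 1) * hookAF q P J K S E0 E1 E2 E3 E4 E5 := by
  have := sub_ne_zero.mpr h1
  simp only [hookAF, hookCoeff, qn]
  field_simp
  ring

theorem hookAF_left_top {q : F} (h0 : q ≠ 0) (h1 : q ≠ 1) (P J U E0 E1 E2 E3 E4 E5 : F) :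
    (U * q - 1) * hookAF q P (J * U) q 1 E0 E1 E2 E3 E4 E5
      = (q - 1) * hookAF q P J (U * q) 1 E0 E1 E2 E3 E4 E5
        + (U * q - q) * hookAF q P (J * U * q) 1 1 E0 E1 E2 E3 E4 E5 := by
  have := sub_ne_zero.mpr h1
  simp only [hookAF, hookCoeff, qn]
  field_simp
  ring

theorem hookAF_base {q : F} (h0 : q ≠ 0) (h1 : q ≠ 1) (S E0 E1 E2 E3 E4 E5 : F) :
    q * hookAF q q 1 1 S E0 E1 E2 E3 E4 E5
      = (1 + q) * (qn q (S / q) * qn q S * hookLowF q q (S * q) 1 E0 E1 E2 E3)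
        - qn q (S / q) * qn q S * qn q (S * q) * qn q (S * q ^ 2)
          * colF q (S * q ^ 2) q E0 E1 := by
  have := sub_ne_zero.mpr h1
  simp only [hookAF, hookCoeff, hookLowF, colF, qn]
  field_simp
  ring

theorem hookAF_diag {q : F} (h0 : q ≠ 0) (h1 : q ≠ 1) (J S E0 E1 E2 E3 E4 E5 : F) :
    (q * S - 1) * (q * hookAF q q (J * q) 1 S E0 E1 E2 E3 E4 E5)
      = (1 + q) * ((S - 1) * hookAF q q J 1 (S * q) E0 E1 E2 E3 E4 E5
          + (q * S - S) * hookAF q q J (S * q) 1 E0 E1 E2 E3 E4 E5)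
        - (q * S - 1) * hookAF q q J 1 (S * q) E0 E1 E2 E3 E4 E5 := by
  have := sub_ne_zero.mpr h1
  simp only [hookAF, hookCoeff, qn]
  field_simp
  ring

theorem hookAF_right {q : F} (h0 : q ≠ 0) (h1 : q ≠ 1) (P J K S E0 E1 E2 E3 E4 E5 : F) :
    (K * S - 1) * hookAF q P J K S E0 E1 E2 E3 E4 E5
      = (S - 1) * hookAF q P J 1 (K * S) E0 E1 E2 E3 E4 E5
        + (K * S - S) * hookAF q P J (K * S) 1 E0 E1 E2 E3 E4 E5 := by
  have := sub_ne_zero.mpr h1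
  simp only [hookAF, hookCoeff, qn]
  field_simp
  ring

theorem hookBF_left {q : F} (h0 : q ≠ 0) (h1 : q ≠ 1) (I J K S E0 E1 E2 E3 E4 E5 : F) :
    (I * J - 1) * hookBF q I J K S E0 E1 E2 E3 E4 E5
      = (J - 1) * (qn q (I * J * K * S / q ^ 2) * qn q (I * J * K * S / q)
          * hookLowF q (I * J) (S * q) K E0 E1 E2 E3)
        + (I * J - J) * hookAF q (I * J) 1 K S E0 E1 E2 E3 E4 E5 := by
  have := sub_ne_zero.mpr h1
  simp only [hookBF, hookAF, hookCoeff, hookLowF, qn]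
  field_simp
  ring

end Algebra

section HookValues

variable {F : Type*} [Field F] {N : ℕ}

/-- The value of `hookX q x (m + 6)` for `c ≤ a ≤ b`. -/
noncomputable def valA (q : F) (x : Fin N → F) (m : ℕ) (P J K S : F) : F :=
  fac q m * hookAF q P J K S (elem x (m + 6)) (elem x (m + 5) * elem x 1)
        (elem x (m + 4) * elem x 2) (elem x (m + 4) * elem x 1 ^ 2) (elem x (m + 3) * elem x 3)
        (elem x (m + 3) * elem x 2 * elem x 1)

/-- The value of `hookX q x (m + 6)` for `a ≤ c < b`. -/
noncomputable def valB (q : F) (x : Fin N → F) (m : ℕ) (I J K S : F) : F :=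
  fac q m * hookBF q I J K S (elem x (m + 6)) (elem x (m + 5) * elem x 1)
        (elem x (m + 4) * elem x 2) (elem x (m + 4) * elem x 1 ^ 2) (elem x (m + 3) * elem x 3)
        (elem x (m + 3) * elem x 2 * elem x 1)

/-- Thresholds of the complete graph with a staircase removed at the last three vertices. -/
def stairThreshold (n a v : ℕ) : ℕ :=
  if v + 1 = n then n - 2 else if v + 2 = n then n - 3 else if v + 3 = n then a else 0

end HookValues

variable {F : Type*} [Field F] [CharZero F] {N : ℕ}

theorem corner_eq {q : F} (x : Fin N → F) (h0 : q ≠ 0) (hq : ∀ k, 0 < k → q ^ k ≠ 1) (m : ℕ) :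
    hookX q x (m + 5) (m + 2) (m + 2) (m + 3) = fac q m * cornerF q (q ^ (m + 2))
      (elem x (m + 5)) (elem x (m + 4) * elem x 1) (elem x (m + 3) * elem x 2)
      (elem x (m + 2) * elem x 3) (elem x (m + 2) * elem x 2 * elem x 1) := by
  have h1 : q ≠ 1 := by simpa using hq 1 one_pos
  have e1 := interpolate_desc (q := q) (g := fun a => chi q x (m + 5) (stairThreshold (m + 5) a))
    0 1 (m + 1) fun a hi hi' => by
      refine chi_column q x (z := m + 2) (k := a) ?_ ?_ ?_ ?_ ?_ ?_ ?_ ?_ ?_ ?_ ?_ <;>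
        intros <;> (try simp only [stairThreshold]) <;> (repeat' split_ifs) <;> omega
  have e2 : chi q x (m + 5) (stairThreshold (m + 5) 0)
      = hookX q x (m + 5) (m + 3) (m + 2) (m + 3) := by
    refine chi_congr q x fun u v huv hv => ?_
    simp only [stairThreshold, hookThreshold]
    split_ifs <;> omega
  have e3 : chi q x (m + 5) (stairThreshold (m + 5) 1)
      = hookX q x (m + 5) (m + 2) (m + 2) (m + 3) := by
    refine chi_congr q x fun u v huv hv => ?_
    simp only [stairThreshold, hookThreshold]
    split_ifs <;> omega
  have e4 : chi q x (m + 5) (stairThreshold (m + 5) (m + 2))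
      = fullX q x (m + 2) * colX q x 3 1 := by
    rw [fullX, ← chi_clique q x (m + 2) (fun _ => 0) fun _ _ => rfl]
    refine chi_split q x (m + 2) 3 ?_ ?_ ?_ <;> intros <;> (try simp only [stairThreshold]) <;>
      (repeat' split_ifs) <;> omega
  have e5 := colsX_eq x h0 hq (m := m + 1) (j := m + 2) (k := 1) (s := 0) (by omega)
  have e6 : colX q x 3 1 = _ := colX_eq x h0 hq (m := 1) (b := 1) (t := 1) (by omega)
  have hM' := pow_eq_div h0 (m := m + 1) (k := 1) (rfl : q ^ (m + 2) = q ^ (m + 1 + 1))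
  simp only [zero_add, show 1 + (m + 1) = m + 2 by omega] at e1
  rw [e2, e3, e4, e5, e6, fullX, fac_succ q (m + 1), fac_succ q m,
    br_eq_qn h1, br_eq_qn h1, hM', pow_zero, pow_one, show fac q 1 = 1 by simp [fac, br]] at e1
  have hne : q ^ (m + 2) - 1 ≠ 0 := sub_ne_zero.mpr (hq _ (by omega))
  refine mul_left_cancel₀ hne ?_
  have key := cornerF_interp h0 h1 (q ^ (m + 2)) (elem x (m + 5)) (elem x (m + 4) * elem x 1)
    (elem x (m + 3) * elem x 2) (elem x (m + 2) * elem x 3) (elem x (m + 2) * elem x 2 * elem x 1)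
  have hc : q * (q ^ (m + 2) / q) = q ^ (m + 2) := by field_simp
  rw [hc] at e1
  simp only [colF, show 1 + 2 = 3 from rfl, show 1 + 1 = 2 from rfl] at e1 key
  linear_combination e1 - fac q m * key

theorem hookX_valA_one {q : F} (x : Fin N → F) (h0 : q ≠ 0) (hq : ∀ k, 0 < k → q ^ k ≠ 1)
    {m j k s : ℕ} (h : j + k + s = m + 3) :
    hookX q x (m + 6) 1 (j + 1) (j + k + 1) = valA q x m 1 (q ^ j) (q ^ k) (q ^ s) := by
  have h1 : q ≠ 1 := by simpa using hq 1 one_pos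
  have e1 := hookX_one_left q x (n := m + 5) (a := j) (b := j + k) (by omega)
  have e2 := colsX_eq x h0 hq (m := m + 1) (j := j) (k := k) (s := s) (by omega)
  have hM := pow_eq_div h0 (show q ^ j * q ^ k * q ^ s = q ^ (m + 1 + 2) by
    rw [← pow_add, ← pow_add, h])
  rw [show m + 5 - 2 = m + 1 + 2 by omega, e2, fac_succ, br_eq_qn h1, hM] at e1
  rw [valA, hookAF_one h0 h1]
  simp only [colsF, show m + 1 + 2 = m + 3 by omega, show m + 1 + 3 = m + 4 by omega,
    show m + 1 + 4 = m + 5 by omega] at e1 ⊢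
  linear_combination e1

theorem hookX_valA_two {q : F} (x : Fin N → F) (h0 : q ≠ 0) (hq : ∀ k, 0 < k → q ^ k ≠ 1)
    {m p j : ℕ} (h : p + j = m + 3) :
    hookX q x (m + 6) (p + 1) (m + 4) (m + 4) = valA q x m (q ^ p) (q ^ j) 1 1 := by
  have h1 : q ≠ 1 := by simpa using hq 1 one_pos
  have e1 := hookX_split_two q x (n := m + 4) (c := p + 1) (by omega)
  have e2 := rowX_eq x h0 hq (m := m + 2) (p := p) (t := j) (by omega)
  have hM := pow_eq_div h0 (show q ^ p * q ^ j = q ^ (m + 1 + 2) by rw [← pow_add, h])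
  have hM' := pow_eq_div h0 (show q ^ p * q ^ j = q ^ (m + 1 + 1 + 1) by rw [← pow_add, h])
  rw [e2, fac_succ, fac_succ, br_eq_qn h1, br_eq_qn h1, hM, hM', fullX,
    show fac q 2 = 1 + q by simp [fac, br, Finset.prod_range_succ, Finset.sum_range_succ],
    pow_one] at e1
  rw [valA, hookAF_two h0 h1]
  simp only [colF, show m + 2 + 2 = m + 4 by omega, show m + 2 + 1 = m + 3 by omega] at e1 ⊢
  linear_combination e1

theorem hookX_valA_corner {q : F} (x : Fin N → F) (h0 : q ≠ 0) (hq : ∀ k, 0 < k → q ^ k ≠ 1)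
    (m : ℕ) : hookX q x (m + 6) (m + 3) (m + 3) (m + 4) = valA q x m (q ^ (m + 2)) 1 q 1 := by
  have h1 : q ≠ 1 := by simpa using hq 1 one_pos
  have e1 := corner_eq x h0 hq (m + 1)
  have hM := pow_eq_div h0 (m := m + 1) (k := 1) (rfl : q ^ (m + 2) = q ^ (m + 1 + 1))
  rw [valA, hookAF_corner h0 h1]
  rw [fac_succ, br_eq_qn h1, hM, show q ^ (m + 1 + 2) = q ^ (m + 2) * q by ring, pow_one] at e1
  simp only [show m + 1 + 5 = m + 6 by omega, show m + 1 + 4 = m + 5 by omega,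
    show m + 1 + 3 = m + 4 by omega, show m + 1 + 2 = m + 3 by omega] at e1
  linear_combination e1

/-- The case `b = n - 2`. -/
theorem hookX_valA_top {q : F} (x : Fin N → F) (h0 : q ≠ 0) (hq : ∀ k, 0 < k → q ^ k ≠ 1)
    {m p j k : ℕ} (h : p + j + k = m + 3) :
    hookX q x (m + 6) (p + 1) (p + j + 1) (m + 4) = valA q x m (q ^ p) (q ^ j) (q ^ k) 1 := by
  have h1 : q ≠ 1 := by simpa using hq 1 one_pos
  have two : ∀ {p j : ℕ}, p + j = m + 2 →
      hookX q x (m + 6) (p + 1) (m + 3) (m + 4) = valA q x m (q ^ p) (q ^ j) q 1 := by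
    intro p j h
    have e1 := interpolate_asc (q := q) (g := fun c => hookX q x (m + 6) c (m + 3) (m + 4)) 1 p j
      fun i hi hi' => hookX_move_top q x (by omega) (by omega) (by omega) (by omega)
    have e2 := hookX_valA_one x h0 hq (m := m) (j := m + 2) (k := 1) (s := 0) (by omega)
    have e3 := hookX_valA_corner x h0 hq m
    simp only [add_comm 1 p, show p + 1 + j = m + 3 by omega] at e1
    rw [e3, e2, pow_zero, pow_one, ← h, pow_add] at e1
    have hne : q ^ p * q ^ j - 1 ≠ 0 := by
      rw [← pow_add]; exact sub_ne_zero.mpr (hq _ (by omega))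
    refine mul_left_cancel₀ hne ?_
    have key := hookAF_row h0 h1 (q ^ p) (q ^ j) q 1 (elem x (m + 6)) (elem x (m + 5) * elem x 1)
        (elem x (m + 4) * elem x 2) (elem x (m + 4) * elem x 1 ^ 2) (elem x (m + 3) * elem x 3)
        (elem x (m + 3) * elem x 2 * elem x 1)
    simp only [valA] at e1 ⊢
    linear_combination e1 - fac q m * key
  rcases k with _ | _ | u
  · rw [show p + j + 1 = m + 4 by omega, pow_zero]
    exact hookX_valA_two x h0 hq (by omega)
  · rw [show p + j + 1 = m + 3 by omega, zero_add, pow_one]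
    exact two (by omega)
  · have e1 := interpolate_desc (q := q) (g := fun a => hookX q x (m + 6) (p + 1) a (m + 4))
      (p + j + 1) (u + 1) 1 fun i hi hi' => hookX_move_left q x (by omega) (by omega) (by omega)
        (by omega) (Or.inl (by omega))
    have e2 := two (p := p) (j := j + (u + 1)) (by omega)
    have e3 := hookX_valA_two x h0 hq (m := m) (p := p) (j := j + (u + 1) + 1) (by omega)
    simp only [show p + j + 1 + (u + 1) = m + 3 by omega, show m + 3 + 1 = m + 4 by omega] at e1
    rw [e2, e3, pow_one, pow_succ q (j + (u + 1)), pow_add q j] at e1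
    refine mul_left_cancel₀ (sub_ne_zero.mpr h1) ?_
    have key := hookAF_left_top h0 h1 (q ^ p) (q ^ j) (q ^ (u + 1)) (elem x (m + 6)) (elem x (m + 5) * elem x 1)
        (elem x (m + 4) * elem x 2) (elem x (m + 4) * elem x 1 ^ 2) (elem x (m + 3) * elem x 3)
        (elem x (m + 3) * elem x 2 * elem x 1)
    rw [pow_succ q (u + 1)]
    simp only [valA] at e1 ⊢
    linear_combination fac q m * key - e1

/-- The case `c = 2`, `a = b`. -/
theorem hookX_valA_diag {q : F} (x : Fin N → F) (h0 : q ≠ 0) (hq : ∀ k, 0 < k → q ^ k ≠ 1)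
    {m : ℕ} (j : ℕ) : ∀ s, j + s = m + 2 →
    hookX q x (m + 6) 2 (j + 2) (j + 2) = valA q x m q (q ^ j) 1 (q ^ s) := by
  have h1 : q ≠ 1 := by simpa using hq 1 one_pos
  induction j with
  | zero =>
    intro s h
    have e1 := hookX_move_diag q x (n := m + 6) (c := 2) (a := 1) (by omega)
    have e2 := hookLow_eq x h0 hq (m := m + 2) (p := 1) (k := 0) (t := s + 1) (by omega) (by omega)
    have e3 := hookX_ones q x (n := m + 6) (c := 2) (by omega)
    have e4 := rowX_eq x h0 hq (m := m + 4) (p := 1) (t := m + 4) (by omega)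
    simp only [show 1 + 1 = 2 from rfl] at e1 e2 e4
    obtain rfl : s = m + 2 := by omega
    have hM := pow_eq_div h0 (m := m + 1) (k := 1) (rfl : q ^ (m + 2) = q ^ (m + 1 + 1))
    rw [e3, e4, e2, fac_succ q (m + 3), fac_succ q (m + 2), fac_succ q (m + 1), fac_succ q m,
      br_eq_qn h1, br_eq_qn h1, br_eq_qn h1, br_eq_qn h1,
      show q ^ (m + 3 + 1) = q ^ (m + 2) * q ^ 2 by ring,
      show q ^ (m + 2 + 1) = q ^ (m + 2) * q by ring,
      show q ^ (m + 1 + 1) = q ^ (m + 2) by ring, hM] at e1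
    simp only [pow_zero, pow_one, zero_add] at e1 ⊢
    refine mul_left_cancel₀ h0 ?_
    have key := hookAF_base h0 h1 (q ^ (m + 2)) (elem x (m + 6)) (elem x (m + 5) * elem x 1)
        (elem x (m + 4) * elem x 2) (elem x (m + 4) * elem x 1 ^ 2) (elem x (m + 3) * elem x 3)
        (elem x (m + 3) * elem x 2 * elem x 1)
    simp only [valA, show m + 2 + 4 = m + 6 by omega,
      show m + 2 + 3 = m + 5 by omega,
      show m + 2 + 2 = m + 4 by omega] at e1 ⊢
    linear_combination - e1 - fac q m * key
  | succ j ih =>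
    intro s h
    have e1 := ih (s + 1) (by omega)
    have e2 := hookX_move_diag q x (n := m + 6) (c := 2) (a := j + 2) (by omega)
    have e3 := interpolate_desc (q := q) (g := fun b => hookX q x (m + 6) 2 (j + 2) b) (j + 2) 1 s
      fun i hi hi' => hookX_move_right q x (by omega) (by omega) (by omega) (by omega)
        (Or.inl (by omega))
    have e4 := hookX_valA_top x h0 hq (m := m) (p := 1) (j := j) (k := s + 1) (by omega)
    simp only [show 1 + 1 = 2 from rfl, show 1 + j + 1 = j + 2 by omega] at e4
    simp only [show j + 2 + 1 + s = m + 4 by omega] at e3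
    rw [e4, e1, pow_one, pow_succ q s] at e3
    rw [e1, pow_succ q s] at e2
    have hne : q * q ^ s - 1 ≠ 0 := by
      rw [← pow_succ']; exact sub_ne_zero.mpr (hq _ (by omega))
    refine mul_left_cancel₀ hne (mul_left_cancel₀ h0 ?_)
    have key := hookAF_diag h0 h1 (q ^ j) (q ^ s) (elem x (m + 6)) (elem x (m + 5) * elem x 1)
        (elem x (m + 4) * elem x 2) (elem x (m + 4) * elem x 1 ^ 2) (elem x (m + 3) * elem x 3)
        (elem x (m + 3) * elem x 2 * elem x 1)
    rw [show j + 1 + 2 = j + 2 + 1 by omega, pow_succ q j]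
    simp only [valA] at e2 e3 ⊢
    linear_combination (1 + q) * e3 - (q * q ^ s - 1) * e2 - fac q m * key

theorem hookX_valA {q : F} (x : Fin N → F) (h0 : q ≠ 0) (hq : ∀ k, 0 < k → q ^ k ≠ 1)
    {m p j k s : ℕ} (h : p + j + k + s = m + 3) :
    hookX q x (m + 6) (p + 1) (p + j + 1) (p + j + k + 1)
      = valA q x m (q ^ p) (q ^ j) (q ^ k) (q ^ s) := by
  have h1 : q ≠ 1 := by simpa using hq 1 one_pos
  have two : ∀ {j k s : ℕ}, j + k + s = m + 2 →
      hookX q x (m + 6) 2 (j + 2) (j + k + 2) = valA q x m q (q ^ j) (q ^ k) (q ^ s) := by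
    intro j k s h
    rcases Nat.eq_zero_or_pos k with rfl | hk
    · simpa using hookX_valA_diag x h0 hq (m := m) j s (by omega)
    have e1 := interpolate_desc (q := q) (g := fun b => hookX q x (m + 6) 2 (j + 2) b) (j + 2) k s
      fun i hi hi' => hookX_move_right q x (by omega) (by omega) (by omega) (by omega)
        (Or.inl (by omega))
    have e2 := hookX_valA_diag x h0 hq (m := m) j (k + s) (by omega)
    have e3 := hookX_valA_top x h0 hq (m := m) (p := 1) (j := j) (k := k + s) (by omega)
    simp only [show 1 + 1 = 2 from rfl, show 1 + j + 1 = j + 2 by omega, pow_one] at e3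
    simp only [show j + 2 + k = j + k + 2 by omega, show j + k + 2 + s = m + 4 by omega] at e1
    rw [e2, e3, pow_add q k] at e1
    have hne : q ^ k * q ^ s - 1 ≠ 0 := by
      rw [← pow_add]; exact sub_ne_zero.mpr (hq _ (by omega))
    refine mul_left_cancel₀ hne ?_
    have key := hookAF_right h0 h1 q (q ^ j) (q ^ k) (q ^ s) (elem x (m + 6)) (elem x (m + 5) * elem x 1)
        (elem x (m + 4) * elem x 2) (elem x (m + 4) * elem x 1 ^ 2) (elem x (m + 3) * elem x 3)
        (elem x (m + 3) * elem x 2 * elem x 1)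
    simp only [valA] at e1 ⊢
    linear_combination e1 - fac q m * key
  rcases p with _ | p
  · simpa using hookX_valA_one x h0 hq (m := m) (j := j) (k := k) (s := s) (by omega)
  have e1 := interpolate_asc (q := q)
    (g := fun c => hookX q x (m + 6) c (p + 1 + j + 1) (p + 1 + j + k + 1)) 1 1 p
    fun i hi hi' => hookX_move_top q x (by omega) (by omega) (by omega) (by omega)
  have e2 := hookX_valA_one x h0 hq (m := m) (j := p + 1 + j) (k := k) (s := s) (by omega)
  have e3 := two (j := p + j) (k := k) (s := s) (by omega)
  simp only [show 1 + 1 + p = p + 1 + 1 by omega] at e1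
  rw [e2, show p + 1 + j + 1 = p + j + 2 by omega, show p + 1 + j + k + 1 = p + j + k + 2 by omega,
    e3, pow_add q (p + 1), pow_one, ← pow_succ'] at e1
  have key := hookAF_row_second h0 h1 (q ^ (p + 1)) (q ^ j) (q ^ k) (q ^ s) (elem x (m + 6)) (elem x (m + 5) * elem x 1)
        (elem x (m + 4) * elem x 2) (elem x (m + 4) * elem x 1 ^ 2) (elem x (m + 3) * elem x 3)
        (elem x (m + 3) * elem x 2 * elem x 1)
  rw [show q ^ (p + 1) * q ^ j / q = q ^ (p + j) by field_simp; ring] at key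
  refine mul_left_cancel₀ (sub_ne_zero.mpr h1) ?_
  rw [show p + 1 + j + 1 = p + j + 2 by omega, show p + 1 + j + k + 1 = p + j + k + 2 by omega]
  simp only [valA] at e1 ⊢
  linear_combination fac q m * key - e1

theorem hookX_valB {q : F} (x : Fin N → F) (h0 : q ≠ 0) (hq : ∀ k, 0 < k → q ^ k ≠ 1)
    {m i j k s : ℕ} (h : i + j + k + s = m + 3) (hk : 1 ≤ k) (hij : 1 ≤ i + j) :
    hookX q x (m + 6) (i + j + 1) (i + 1) (i + j + k + 1)
      = valB q x m (q ^ i) (q ^ j) (q ^ k) (q ^ s) := by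
  have h1 : q ≠ 1 := by simpa using hq 1 one_pos
  have e1 := interpolate_desc (q := q)
    (g := fun a => hookX q x (m + 6) (i + j + 1) a (i + j + k + 1)) 1 i j
    fun a hi hi' => hookX_move_left q x (by omega) (by omega) (by omega) (by omega)
      (Or.inl (by omega))
  have e2 := hookLow_eq x h0 hq (m := m + 2) (p := i + j) (k := k) (t := s + 1) (by omega)
    (by omega)
  have e3 := hookX_valA x h0 hq (m := m) (p := i + j) (j := 0) (k := k) (s := s) (by omega)
  have hM := pow_eq_div h0 (show q ^ i * q ^ j * q ^ k * q ^ s = q ^ (m + 1 + 2) by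
    rw [← pow_add, ← pow_add, ← pow_add, h])
  have hM' := pow_eq_div h0 (show q ^ i * q ^ j * q ^ k * q ^ s = q ^ (m + 1 + 1 + 1) by
    rw [← pow_add, ← pow_add, ← pow_add, h])
  simp only [add_zero, pow_zero] at e3
  simp only [add_comm 1 i, show i + 1 + j = i + j + 1 by omega] at e1
  rw [e3, show i + j + k + 1 = i + j + 1 + k by omega, e2, fac_succ, fac_succ, br_eq_qn h1,
    br_eq_qn h1, hM, hM', pow_one, pow_succ q s, pow_add q i j] at e1
  have hne : q ^ i * q ^ j - 1 ≠ 0 := by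
    rw [← pow_add]; exact sub_ne_zero.mpr (hq _ (by omega))
  refine mul_left_cancel₀ hne ?_
  have key := hookBF_left h0 h1 (q ^ i) (q ^ j) (q ^ k) (q ^ s) (elem x (m + 6)) (elem x (m + 5) * elem x 1)
        (elem x (m + 4) * elem x 2) (elem x (m + 4) * elem x 1 ^ 2) (elem x (m + 3) * elem x 3)
        (elem x (m + 3) * elem x 2 * elem x 1)
  rw [show i + j + k + 1 = i + j + 1 + k by omega]
  simp only [valA, valB, show m + 2 + 4 = m + 6 by omega, show m + 2 + 3 = m + 5 by omega,
    show m + 2 + 2 = m + 4 by omega] at e1 ⊢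
  linear_combination e1 - fac q m * key

section Positive

variable {L : Type*} [Field L]

/-- The values at `q` of the polynomials with natural number coefficients. -/
noncomputable def positives (q : L) : Subsemiring L :=
  (Polynomial.eval₂RingHom (Nat.castRingHom L) q).rangeS

theorem self_mem_positives (q : L) : q ∈ positives q := ⟨Polynomial.X, by simp⟩

theorem pow_mem_positives (q : L) (k : ℕ) : q ^ k ∈ positives q :=
  pow_mem (self_mem_positives q) k

theorem br_mem_positives (q : L) (k : ℕ) : br q k ∈ positives q :=
  sum_mem fun i _ => pow_mem_positives q i

theorem fac_mem_positives (q : L) (k : ℕ) : fac q k ∈ positives q :=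
  prod_mem fun i _ => br_mem_positives q (i + 1)

theorem br_add (q : L) (a b : ℕ) : br q (a + b) = br q a + q ^ a * br q b := by
  simp only [br, Finset.sum_range_add, Finset.mul_sum, pow_add]

theorem br_sub_mem_positives (q : L) {a b : ℕ} (h : b ≤ a) : br q a - br q b ∈ positives q := by
  obtain ⟨c, rfl⟩ := Nat.exists_eq_add_of_le h
  rw [br_add, add_sub_cancel_left]
  exact mul_mem (pow_mem_positives q b) (br_mem_positives q c)

theorem div_eq_pow {q : L} (h0 : q ≠ 0) {A : L} {k l : ℕ} (h : A = q ^ (k + l)) :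
    A / q ^ l = q ^ k := (pow_eq_div h0 h).symm

theorem hookAF_second_mem {q : L} (h1 : q ≠ 1) (u r s k : ℕ) (hr : r = k + s) (hu : 2 ≤ u) (h1r : 1 ≤ r) :
    q ^ r * (br q u - br q s) * br q (u + r - 3)
      + q ^ (u + r - 2) * br q 3 * br q s * br q (r - 1) ∈ positives q := by
  have hq := self_mem_positives q
  have hp := pow_mem_positives q
  have hb := br_mem_positives q
  rcases le_or_gt s u with h | h
  · exact add_mem (mul_mem (mul_mem (hp _) (br_sub_mem_positives q h)) (hb _))
      (mul_mem (mul_mem (mul_mem (hp _) (hb _)) (hb _)) (hb _))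
  obtain ⟨v, rfl⟩ := Nat.exists_eq_add_of_le' hu
  obtain ⟨w, rfl⟩ := Nat.exists_eq_add_of_le h.le
  subst hr
  have e : q ^ (k + (v + 2 + w)) * (br q (v + 2) - br q (v + 2 + w))
        * br q (v + 2 + (k + (v + 2 + w)) - 3)
      + q ^ (v + 2 + (k + (v + 2 + w)) - 2) * br q 3 * br q (v + 2 + w)
        * br q (k + (v + 2 + w) - 1)
      = q ^ (v + (k + (v + 2 + w))) * (q ^ 2 * br q (v + 1 + w + k) * (q ^ w * br q (v + 2))
        + q * br q (v + 2 + w) * br q (v + 1 + w + k)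
        + br q (w + 2) * (br q (v + 1 + k) + q ^ (v + 1 + k) * br q w)
        + q ^ (w + 2) * br q v * br q (v + 1 + k)) := by
    rw [show v + 2 + (k + (v + 2 + w)) - 3 = v + (v + 1 + w + k) by omega,
      show v + 2 + (k + (v + 2 + w)) - 2 = v + (k + (v + 2 + w)) by omega,
      show k + (v + 2 + w) - 1 = v + 1 + w + k by omega]
    simp only [br_eq_qn h1, qn]
    field_simp [sub_ne_zero.mpr h1]
    ring
  rw [e]
  refine mul_mem (hp _) (add_mem (add_mem (add_mem ?_ ?_) ?_) ?_)
  · exact mul_mem (mul_mem (hp _) (hb _)) (mul_mem (hp _) (hb _))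
  · exact mul_mem (mul_mem hq (hb _)) (hb _)
  · exact mul_mem (hb _) (add_mem (hb _) (mul_mem (hp _) (hb _)))
  · exact mul_mem (mul_mem (hp _) (hb _)) (hb _)

theorem hookBF_second_mem {q : L} (h1 : q ≠ 1) (i j p r s k : ℕ) (hp : p = i + j) (hr : r = k + s)
    (hk : 1 ≤ k) (hi : 1 ≤ i) :
    (br q p * br q (i + 1) + br q s * (q ^ (i + 1) * br q j - br q i)) * br q (p + r - 2)
      + q ^ (p - 1) * br q 3 * br q s * br q i * br q (r - 1) ∈ positives q := by
  have hq := self_mem_positives q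
  have hpw := pow_mem_positives q
  have hb := br_mem_positives q
  rw [br_add q i 1, show br q 1 = 1 by simp [br], mul_one]
  rcases le_or_gt s p with h | h
  · rw [show br q p * (br q i + q ^ i) + br q s * (q ^ (i + 1) * br q j - br q i)
      = br q i * (br q p - br q s) + q ^ i * br q p + br q s * (q ^ (i + 1) * br q j) by ring]
    refine add_mem (mul_mem (add_mem (add_mem ?_ ?_) ?_) (hb _)) ?_
    · exact mul_mem (hb _) (br_sub_mem_positives q h)
    · exact mul_mem (hpw _) (hb _)
    · exact mul_mem (hb _) (mul_mem (hpw _) (hb _))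
    · exact mul_mem (mul_mem (mul_mem (mul_mem (hpw _) (hb _)) (hb _)) (hb _)) (hb _)
  obtain ⟨v, rfl⟩ := Nat.exists_eq_add_of_le' (show 1 ≤ p by omega)
  obtain ⟨w, rfl⟩ := Nat.exists_eq_add_of_le h.le
  subst hr
  have e : (br q (v + 1) * (br q i + q ^ i)
        + br q (v + 1 + w) * (q ^ (i + 1) * br q j - br q i))
        * br q (v + 1 + (k + (v + 1 + w)) - 2)
      + q ^ (v + 1 - 1) * br q 3 * br q (v + 1 + w) * br q i * br q (k + (v + 1 + w) - 1)
      = (q ^ i * br q (v + 1) + br q (v + 1 + w) * (q ^ (i + 1) * br q j))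
          * br q (v + (k + (v + w)))
        + q ^ v * br q i * (q * br q (k + (v + w)) * (q ^ w * br q (v + 1))
          + q ^ 2 * br q (v + 1 + w) * br q (k + (v + w))
          + br q (w + 1) * (br q (v + k) + q ^ (v + k) * br q w)
          + q ^ (w + 1) * br q v * br q (v + k)) := by
    rw [show v + 1 + (k + (v + 1 + w)) - 2 = v + (k + (v + w)) by omega,
      show v + 1 - 1 = v by omega, show k + (v + 1 + w) - 1 = k + (v + w) by omega]
    simp only [br_eq_qn h1, qn]
    field_simp [sub_ne_zero.mpr h1]
    ring
  rw [e]
  refine add_mem (mul_mem (add_mem ?_ ?_) (hb _)) (mul_mem (mul_mem (hpw _) (hb _))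
    (add_mem (add_mem (add_mem ?_ ?_) ?_) ?_))
  · exact mul_mem (hpw _) (hb _)
  · exact mul_mem (hb _) (mul_mem (hpw _) (hb _))
  · exact mul_mem (mul_mem hq (hb _)) (mul_mem (hpw _) (hb _))
  · exact mul_mem (mul_mem (hpw _) (hb _)) (hb _)
  · exact mul_mem (hb _) (add_mem (hb _) (mul_mem (hpw _) (hb _)))
  · exact mul_mem (mul_mem (hpw _) (hb _)) (hb _)
theorem colF_mem {q : L} (h1 : q ≠ 1)
    {b t m : ℕ} (h : b + t = m + 1) :
    colF q (q ^ b) (q ^ t) 1 0 ∈ positives q ∧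
    colF q (q ^ b) (q ^ t) 0 1 ∈ positives q := by
  have hS := self_mem_positives q
  have h1S := (positives q).one_mem
  have hp := pow_mem_positives q
  have hb := br_mem_positives q
  have e : q ^ b * q ^ t * q = q ^ (m + 2) := by rw [← pow_add, h]; ring
  simp only [colF, e, ← br_eq_qn h1, mul_one, mul_zero, add_zero, zero_add]
  refine ⟨?_, ?_⟩
  · repeat' first
      | assumption | exact hp _ | exact hb _ | exact hS | exact h1S
      | apply add_mem | apply mul_mem
  · repeat' first
      | assumption | exact hp _ | exact hb _ | exact hS | exact h1S
      | apply add_mem | apply mul_mem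

theorem colsF_mem {q : L} (h0 : q ≠ 0) (h1 : q ≠ 1)
    {j k s m : ℕ} (h : j + k + s = m + 2) :
    colsF q (q ^ j) (q ^ k) (q ^ s) 1 0 0 ∈ positives q ∧
    colsF q (q ^ j) (q ^ k) (q ^ s) 0 1 0 ∈ positives q ∧
    colsF q (q ^ j) (q ^ k) (q ^ s) 0 0 1 ∈ positives q := by
  have hS := self_mem_positives q
  have h1S := (positives q).one_mem
  have hp := pow_mem_positives q
  have hb := br_mem_positives q
  have e1 : q ^ j * q ^ k * q ^ s = q ^ (m + 2) := by rw [← pow_add, ← pow_add, h]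
  have e2 : q ^ (m + 2) * q ^ 2 = q ^ (m + 4) := by ring
  have e3 : q ^ (m + 2) / q = q ^ (m + 1) := by field_simp; ring
  have e4 : q ^ s * q = q ^ (s + 1) := by ring
  have e5 : q ^ k * q ^ s = q ^ (k + s) := by ring
  have e6 : br q j * br q 2 * qn q (q ^ j * q ^ k / q) ∈ positives q := by
    rcases j with _ | j
    · simp [br]
    · rw [show q ^ (j + 1) * q ^ k / q = q ^ (j + k) by field_simp; ring, ← br_eq_qn h1]
      exact mul_mem (mul_mem (hb _) (hb _)) (hb _)
  simp only [colsF, e1, e2, e3, e4, e5, ← br_eq_qn h1, mul_one, mul_zero, add_zero, zero_add]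
  refine ⟨?_, ?_, ?_⟩
  · repeat' first
      | assumption | exact hp _ | exact hb _ | exact hS | exact h1S
      | apply add_mem | apply mul_mem
  · repeat' first
      | assumption | exact hp _ | exact hb _ | exact hS | exact h1S
      | apply add_mem | apply mul_mem
  · rw [show q ^ k * (q ^ s) ^ 2 * br q j * (1 + q) * qn q (q ^ j * q ^ k / q)
      = q ^ k * (q ^ s) ^ 2 * (br q j * br q 2 * qn q (q ^ j * q ^ k / q)) by
        simp [br, Finset.sum_range_succ]; ring]
    exact mul_mem (mul_mem (hp _) (pow_mem (hp _) 2)) e6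

theorem hookLowF_mem {q : L} (h0 : q ≠ 0) (h1 : q ≠ 1)
    {p t k m : ℕ} (h : p + k + t = m + 2) (hp1 : 1 ≤ p) :
    hookLowF q (q ^ p) (q ^ t) (q ^ k) 1 0 0 0 ∈ positives q ∧
    hookLowF q (q ^ p) (q ^ t) (q ^ k) 0 1 0 0 ∈ positives q ∧
    hookLowF q (q ^ p) (q ^ t) (q ^ k) 0 0 1 0 ∈ positives q ∧
    hookLowF q (q ^ p) (q ^ t) (q ^ k) 0 0 0 1 ∈ positives q := by
  have hS := self_mem_positives q
  have h1S := (positives q).one_mem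
  have hp := pow_mem_positives q
  have hb := br_mem_positives q
  have e1 : q ^ p * q ^ t * q ^ k = q ^ (m + 2) := by
    rw [← pow_add, ← pow_add, ← h]; ring
  have e2 : q ^ (m + 2) * q ^ 2 = q ^ (m + 4) := by ring
  have e3 : q ^ (m + 2) / q = q ^ (m + 1) := by field_simp; ring
  have e4 : q ^ (m + 2) * q = q ^ (m + 3) := by ring
  have e5 := br_sub_mem_positives q (show t ≤ m + 1 by omega)
  have e6 := br_sub_mem_positives q (show p ≤ m + 3 by omega)
  simp only [hookLowF, e1, e2, e3, e4, ← br_eq_qn h1, mul_one, mul_zero, add_zero, zero_add]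
  refine ⟨?_, ?_, ?_, ?_⟩
  · repeat' first
      | assumption | exact hp _ | exact hb _ | exact hS | exact h1S
      | apply add_mem | apply mul_mem
  · repeat' first
      | assumption | exact hp _ | exact hb _ | exact hS | exact h1S
      | apply add_mem | apply mul_mem
  · repeat' first
      | assumption | exact hp _ | exact hb _ | exact hS | exact h1S
      | apply add_mem | apply mul_mem
  · repeat' first
      | assumption | exact hp _ | exact hb _ | exact hS | exact h1S
      | apply add_mem | apply mul_mem

theorem hookHighF_mem {q : L} (h0 : q ≠ 0) (h1 : q ≠ 1)
    {i j k m : ℕ} (h : i + j + k = m + 2) (hk : 1 ≤ k) :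
    hookHighF q (q ^ i) (q ^ j) (q ^ k) 1 0 0 ∈ positives q ∧
    hookHighF q (q ^ i) (q ^ j) (q ^ k) 0 1 0 ∈ positives q ∧
    hookHighF q (q ^ i) (q ^ j) (q ^ k) 0 0 1 ∈ positives q := by
  have hS := self_mem_positives q
  have h1S := (positives q).one_mem
  have hp := pow_mem_positives q
  have hb := br_mem_positives q
  obtain ⟨k, rfl⟩ := Nat.exists_eq_add_of_le' hk
  have e1 : q ^ (i + j) * q ^ (k + 1) = q ^ (m + 2) := by rw [← pow_add, h]
  have e2 : q ^ (m + 2) * q ^ 2 = q ^ (m + 4) := by ring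
  have e3 : q ^ (m + 2) / q = q ^ (m + 1) := by field_simp; ring
  have e4 : q ^ i * q ^ j = q ^ (i + j) := by ring
  have e5 : q ^ j * q ^ (k + 1) = q ^ (j + k + 1) := by ring
  have e6 : q ^ (k + 1) * q = q ^ (k + 2) := by ring
  have e7 : q ^ i * (q ^ j) ^ 2 * q ^ (k + 1) / q = q ^ i * (q ^ j) ^ 2 * q ^ k := by
    field_simp; ring
  have e8 : q ^ (j + k + 1) * br q (i + j) * br q i + q ^ (i + j) * br q (k + 1) ^ 2
      + q ^ (m + 1) * br q j * br q (k + 2) - q ^ (m + 1)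
      = q ^ (j + k + 1) * br q (i + j) * br q i + q ^ (i + j) * (br q k * br q (k + 2))
      + q ^ (m + 1) * br q j * br q (k + 2) := by
    rw [show m + 1 = i + j + k by omega]
    simp only [br_eq_qn h1, qn]
    field_simp [sub_ne_zero.mpr h1]
    ring
  simp only [hookHighF, e1, e2, e3, e4, e5, e6, e7, ← br_eq_qn h1, mul_one, mul_zero, add_zero, zero_add]
  refine ⟨?_, ?_, ?_⟩
  · repeat' first
      | assumption | exact hp _ | exact hb _ | exact hS | exact h1S
      | apply add_mem | apply mul_mem
  · rw [e8]
    repeat' first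
      | assumption | exact hp _ | exact hb _ | exact hS | exact h1S
      | apply add_mem | apply mul_mem
  · repeat' first
      | assumption | exact hp _ | exact hb _ | exact hS | exact h1S
      | apply add_mem | apply mul_mem | apply pow_mem

theorem cornerF_mem {q : L} (h0 : q ≠ 0) (h1 : q ≠ 1)
    {m : ℕ}  :
    cornerF q (q ^ (m + 2)) 1 0 0 0 0 ∈ positives q ∧
    cornerF q (q ^ (m + 2)) 0 1 0 0 0 ∈ positives q ∧
    cornerF q (q ^ (m + 2)) 0 0 1 0 0 ∈ positives q ∧
    cornerF q (q ^ (m + 2)) 0 0 0 1 0 ∈ positives q ∧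
    cornerF q (q ^ (m + 2)) 0 0 0 0 1 ∈ positives q := by
  have hS := self_mem_positives q
  have h1S := (positives q).one_mem
  have hp := pow_mem_positives q
  have hb := br_mem_positives q
  have e1 : q ^ (m + 2) / q = q ^ (m + 1) := by field_simp; ring
  have e2 : q ^ (m + 2) * q ^ 2 = q ^ (m + 4) := by ring
  have e3 : q ^ (m + 2) * q ^ 3 = q ^ (m + 5) := by ring
  have e4 : q ^ (m + 2) / q ^ 2 = q ^ m := by field_simp; ring
  have e5 := br_sub_mem_positives q (show m + 1 ≤ m + 4 by omega)
  simp only [cornerF, e1, e2, e3, e4, ← br_eq_qn h1, mul_one, mul_zero, add_zero, zero_add]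
  refine ⟨?_, ?_, ?_, ?_, ?_⟩
  · repeat' first
      | assumption | exact hp _ | exact hb _ | exact hS | exact h1S
      | apply add_mem | apply mul_mem | apply pow_mem
  · repeat' first
      | assumption | exact hp _ | exact hb _ | exact hS | exact h1S
      | apply add_mem | apply mul_mem
  · repeat' first
      | assumption | exact hp _ | exact hb _ | exact hS | exact h1S
      | apply add_mem | apply mul_mem | apply pow_mem
  · repeat' first
      | assumption | exact hp _ | exact hb _ | exact hS | exact h1S
      | apply add_mem | apply mul_mem
  · repeat' first
      | assumption | exact hp _ | exact hb _ | exact hS | exact h1S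
      | apply add_mem | apply mul_mem

theorem hookAF_mem {q : L} (h0 : q ≠ 0) (h1 : q ≠ 1)
    {p j k s m : ℕ} (h : p + j + k + s = m + 3) (hp1 : 1 ≤ p)
    (hj : 1 ≤ j) (hks : 1 ≤ k + s) :
    hookAF q (q ^ p) (q ^ j) (q ^ k) (q ^ s) 1 0 0 0 0 0 ∈ positives q ∧
    hookAF q (q ^ p) (q ^ j) (q ^ k) (q ^ s) 0 1 0 0 0 0 ∈ positives q ∧
    hookAF q (q ^ p) (q ^ j) (q ^ k) (q ^ s) 0 0 1 0 0 0 ∈ positives q ∧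
    hookAF q (q ^ p) (q ^ j) (q ^ k) (q ^ s) 0 0 0 1 0 0 ∈ positives q ∧
    hookAF q (q ^ p) (q ^ j) (q ^ k) (q ^ s) 0 0 0 0 1 0 ∈ positives q ∧
    hookAF q (q ^ p) (q ^ j) (q ^ k) (q ^ s) 0 0 0 0 0 1 ∈ positives q := by
  have hS := self_mem_positives q
  have h1S := (positives q).one_mem
  have hp := pow_mem_positives q
  have hb := br_mem_positives q
  have e0 : q ^ p * q ^ j * q ^ k * q ^ s = q ^ (m + 3) := by
    rw [← pow_add, ← pow_add, ← pow_add, h]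
  have e1 : q ^ (m + 3) / q ^ 2 = q ^ (m + 1) := div_eq_pow h0 rfl
  have e2 : q ^ (m + 3) / q = q ^ (m + 2) := by field_simp; ring
  have e3 : q ^ (m + 3) * q ^ 2 = q ^ (m + 5) := by ring
  have e4 : q ^ (m + 3) * q ^ 3 = q ^ (m + 6) := by ring
  have e5 : q ^ k * q ^ s = q ^ (k + s) := by ring
  have e6 : q ^ s * q = q ^ (s + 1) := by ring
  have e7 : q ^ (k + s) / q = q ^ (k + s - 1) := by
    rw [div_eq_iff h0, ← pow_succ]; congr 1; omega
  have e8 : q ^ j * q ^ k * q ^ s / q = q ^ (j + k + s - 1) := by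
    rw [div_eq_iff h0, ← pow_succ, ← pow_add, ← pow_add]; congr 1; omega
  have e9 : q ^ p * q ^ j * q ^ k / q = q ^ (p + j + k - 1) := by
    rw [div_eq_iff h0, ← pow_succ, ← pow_add, ← pow_add]; congr 1; omega
  have e10 : q ^ p * q ^ j / q = q ^ (p + j - 1) := by
    rw [div_eq_iff h0, ← pow_succ, ← pow_add]; congr 1; omega
  have e11 : q ^ p * q ^ j * q = q ^ (p + j + 1) := by ring
  have d1 := br_sub_mem_positives q (show p ≤ m + 5 by omega)
  have d2 := br_sub_mem_positives q (show k + s ≤ m + 2 by omega)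
  have d3 : br q (k + s) * br q (m + 1) - br q s * br q (k + s - 1) ∈ positives q := by
    rw [show br q (k + s) * br q (m + 1) - br q s * br q (k + s - 1)
      = (br q (k + s) - br q s) * br q (m + 1) + br q s * (br q (m + 1) - br q (k + s - 1)) by ring]
    exact add_mem (mul_mem (br_sub_mem_positives q (by omega)) (hb _))
      (mul_mem (hb _) (br_sub_mem_positives q (by omega)))
  have d4 := hookAF_second_mem h1 (p + j + 1) (k + s) s k rfl (by omega) hks
  rw [show p + j + 1 + (k + s) - 3 = m + 1 by omega,
    show p + j + 1 + (k + s) - 2 = m + 2 by omega] at d4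
  simp only [hookAF, hookCoeff, e0, e1, e2, e3, e4, e5, e6, e7, e8, e9, e10, e11, ← br_eq_qn h1, mul_one, mul_zero, add_zero, zero_add]
  refine ⟨?_, ?_, ?_, ?_, ?_, ?_⟩
  · repeat' first
      | assumption | exact hp _ | exact hb _ | exact hS | exact h1S
      | apply add_mem | apply mul_mem
  · repeat' first
      | assumption | exact hp _ | exact hb _ | exact hS | exact h1S
      | apply add_mem | apply mul_mem
  · repeat' first
      | assumption | exact hp _ | exact hb _ | exact hS | exact h1S
      | apply add_mem | apply mul_mem
  · repeat' first
      | assumption | exact hp _ | exact hb _ | exact hS | exact h1S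
      | apply add_mem | apply mul_mem
  · repeat' first
      | assumption | exact hp _ | exact hb _ | exact hS | exact h1S
      | apply add_mem | apply mul_mem
  · repeat' first
      | assumption | exact hp _ | exact hb _ | exact hS | exact h1S
      | apply add_mem | apply mul_mem | apply pow_mem

theorem hookBF_mem {q : L} (h0 : q ≠ 0) (h1 : q ≠ 1)
    {i j k s m : ℕ} (h : i + j + k + s = m + 3) (hi : 1 ≤ i)
    (hk : 1 ≤ k) :
    hookBF q (q ^ i) (q ^ j) (q ^ k) (q ^ s) 1 0 0 0 0 0 ∈ positives q ∧
    hookBF q (q ^ i) (q ^ j) (q ^ k) (q ^ s) 0 1 0 0 0 0 ∈ positives q ∧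
    hookBF q (q ^ i) (q ^ j) (q ^ k) (q ^ s) 0 0 1 0 0 0 ∈ positives q ∧
    hookBF q (q ^ i) (q ^ j) (q ^ k) (q ^ s) 0 0 0 1 0 0 ∈ positives q ∧
    hookBF q (q ^ i) (q ^ j) (q ^ k) (q ^ s) 0 0 0 0 1 0 ∈ positives q ∧
    hookBF q (q ^ i) (q ^ j) (q ^ k) (q ^ s) 0 0 0 0 0 1 ∈ positives q := by
  have hS := self_mem_positives q
  have h1S := (positives q).one_mem
  have hp := pow_mem_positives q
  have hb := br_mem_positives q
  have e0 : q ^ (i + j) * q ^ k * q ^ s = q ^ (m + 3) := by rw [← pow_add, ← pow_add, h]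
  have e1 : q ^ (m + 3) / q ^ 2 = q ^ (m + 1) := div_eq_pow h0 rfl
  have e2 : q ^ (m + 3) / q = q ^ (m + 2) := by field_simp; ring
  have e3 : q ^ (m + 3) * q ^ 2 = q ^ (m + 5) := by ring
  have e4 : q ^ (m + 3) * q ^ 3 = q ^ (m + 6) := by ring
  have e5 : q ^ j * q ^ k * q ^ s = q ^ (j + k + s) := by ring
  have e6 : q ^ s * q = q ^ (s + 1) := by ring
  have e7 : q ^ k * q ^ s / q = q ^ (k + s - 1) := by
    rw [div_eq_iff h0, ← pow_succ, ← pow_add]; congr 1; omega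
  have e8 : q ^ (j + k + s) / q = q ^ (j + k + s - 1) := by
    rw [div_eq_iff h0, ← pow_succ]; congr 1; omega
  have e10 : q ^ (i + j) / q = q ^ (i + j - 1) := by
    rw [div_eq_iff h0, ← pow_succ]; congr 1; omega
  have e11 : q ^ i * q ^ j = q ^ (i + j) := by ring
  have e12 : q ^ i * q = q ^ (i + 1) := by ring
  have d1 := br_sub_mem_positives q (show i + j ≤ m + 5 by omega)
  have d2 := br_sub_mem_positives q (show j + k + s ≤ m + 2 by omega)
  have d3 : br q (j + k + s) * br q (m + 1) - br q s * br q (j + k + s - 1) ∈ positives q := by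
    rw [show br q (j + k + s) * br q (m + 1) - br q s * br q (j + k + s - 1)
      = (br q (j + k + s) - br q s) * br q (m + 1)
        + br q s * (br q (m + 1) - br q (j + k + s - 1)) by ring]
    exact add_mem (mul_mem (br_sub_mem_positives q (by omega)) (hb _))
      (mul_mem (hb _) (br_sub_mem_positives q (by omega)))
  have d4 := hookBF_second_mem h1 i j (i + j) (k + s) s k rfl rfl hk hi
  rw [show i + j + (k + s) - 2 = m + 1 by omega] at d4
  have d5 : (q ^ (j + k + s) * br q (i + j) * br q (i + 1)
      + br q s * (q ^ (m + 3) * q * br q j - q ^ j * br q i * (q ^ k * q ^ s))) * br q (m + 1)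
      + br q s * q ^ j * br q i * q ^ (m + 2) * br q 3 * br q (k + s - 1) ∈ positives q := by
    convert mul_mem (hp (j + k + s)) d4 using 1
    rw [show q ^ (m + 3) = q ^ (j + k + s) * q ^ i by rw [← h]; ring,
      show q ^ (m + 2) = q ^ (k + s) * q ^ (i + j - 1) by rw [← pow_add]; congr 1; omega]
    ring
  simp only [hookBF, hookCoeff, e0, e1, e2, e3, e4, e5, e6, e7, e8, e10, e11, e12, ← br_eq_qn h1, mul_one, mul_zero, add_zero, zero_add]
  refine ⟨?_, ?_, ?_, ?_, ?_, ?_⟩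
  · repeat' first
      | assumption | exact hp _ | exact hb _ | exact hS | exact h1S
      | apply add_mem | apply mul_mem
  · repeat' first
      | assumption | exact hp _ | exact hb _ | exact hS | exact h1S
      | apply add_mem | apply mul_mem
  · repeat' first
      | assumption | exact hp _ | exact hb _ | exact hS | exact h1S
      | apply add_mem | apply mul_mem
  · repeat' first
      | assumption | exact hp _ | exact hb _ | exact hS | exact h1S
      | apply add_mem | apply mul_mem
  · repeat' first
      | assumption | exact hp _ | exact hb _ | exact hS | exact h1S
      | apply add_mem | apply mul_mem
  · repeat' first
      | assumption | exact hp _ | exact hb _ | exact hS | exact h1S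
      | apply add_mem | apply mul_mem

end Positive

section Expansion

variable {L : Type} [Field L] {A : ℕ → Type} [∀ N, Field (A N)] [∀ N, Algebra L (A N)]

/-- A family of elements is `e`-positive of degree `n` if it is a combination of products of
elementary symmetric polynomials whose coefficients are in `positives q` and do not depend on the
number of variables. -/
def EPositive (q : L) (x : ∀ N, Fin N → A N) (n : ℕ) (Φ : ∀ N, A N) : Prop :=
  ∃ c : Nat.Partition n → L, (∀ P, c P ∈ positives q) ∧
    ∀ N, Φ N = ∑ P, algebraMap L (A N) (c P) * (P.parts.map (elem (x N))).prod

variable {q : L} {x : ∀ N, Fin N → A N} {n : ℕ}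

theorem EPositive.add {Φ Ψ : ∀ N, A N} (h : EPositive q x n Φ) (h' : EPositive q x n Ψ) :
    EPositive q x n fun N => Φ N + Ψ N := by
  obtain ⟨c, hc, e⟩ := h
  obtain ⟨c', hc', e'⟩ := h'
  refine ⟨fun P => c P + c' P, fun P => add_mem (hc P) (hc' P), fun N => ?_⟩
  simp only [e, e', ← Finset.sum_add_distrib, map_add, add_mul]

theorem EPositive.sum {ι : Type*} (s : Finset ι) {Φ : ι → ∀ N, A N}
    (h : ∀ i, EPositive q x n (Φ i)) : EPositive q x n fun N => ∑ i ∈ s, Φ i N := by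
  induction s using Finset.induction_on with
  | empty => exact ⟨fun _ => 0, fun _ => zero_mem _, fun N => by simp⟩
  | insert a s ha ih => simpa only [Finset.sum_insert ha] using (h a).add ih

theorem elem_zero {F : Type*} [Field F] {N : ℕ} (x : Fin N → F) : elem x 0 = 1 := by simp [elem]

theorem prod_elem_filter {F : Type*} [Field F] {N : ℕ} (x : Fin N → F) (l : Multiset ℕ) :
    ((l.filter (· ≠ 0)).map (elem x)).prod = (l.map (elem x)).prod := by
  induction l using Multiset.induction_on with
  | empty => rfl
  | cons r l ih =>
    by_cases hr : r = 0
    · simp [hr, elem_zero, ih]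
    · simp [hr, ih]

theorem EPositive.single (l : Multiset ℕ) (hl : l.sum = n) {a : L} (ha : a ∈ positives q) :
    EPositive q x n fun N => algebraMap L (A N) a * (l.map (elem (x N))).prod := by
  refine ⟨fun P => if P = Nat.Partition.ofSums n l hl then a else 0, fun P => ?_, fun N => ?_⟩
  · dsimp only
    split_ifs
    exacts [ha, zero_mem _]
  · rw [Finset.sum_eq_single (Nat.Partition.ofSums n l hl) (fun P _ hP => by simp [hP])
      (fun h => absurd (Finset.mem_univ _) h)]
    simp [Nat.Partition.ofSums, prod_elem_filter]

theorem EPositive.elem_mul {Φ : ∀ N, A N} (r : ℕ) (h : EPositive q x n Φ) :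
    EPositive q x (r + n) fun N => elem (x N) r * Φ N := by
  obtain ⟨c, hc, e⟩ := h
  have := EPositive.sum (q := q) (x := x) (n := r + n) Finset.univ
    (Φ := fun P N => algebraMap L (A N) (c P) * ((r ::ₘ P.parts).map (elem (x N))).prod)
    fun P => EPositive.single _ (by simp [P.parts_sum]) (hc P)
  convert this using 2 with N
  rw [e N, Finset.mul_sum]
  refine Finset.sum_congr rfl fun P _ => ?_
  rw [Multiset.map_cons, Multiset.prod_cons, mul_left_comm]

theorem EPositive.mul_left {Φ : ∀ N, A N} {a : L} (ha : a ∈ positives q)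
    (h : EPositive q x n Φ) : EPositive q x n fun N => algebraMap L (A N) a * Φ N := by
  obtain ⟨c, hc, e⟩ := h
  refine ⟨fun P => a * c P, fun P => mul_mem ha (hc P), fun N => ?_⟩
  simp only [e, Finset.mul_sum, map_mul, mul_assoc]

theorem map_fac {F : Type*} [Field F] [Algebra L F] (q : L) (m : ℕ) :
    algebraMap L F (fac q m) = fac (algebraMap L F q) m := by
  simp [fac, br]

theorem EPositive.fac_mul {Φ : ∀ N, A N} (m : ℕ) (h : EPositive q x n Φ) :
    EPositive q x n fun N => fac (algebraMap L (A N) q) m * Φ N := by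
  simpa only [map_fac] using h.mul_left (fac_mem_positives q m)

end Expansion

section ClosedForms

variable {L : Type} [Field L] {A : ℕ → Type} [∀ N, Field (A N)] [∀ N, Algebra L (A N)]
  {q : L} {x : ∀ N, Fin N → A N}

theorem colF_linear {F : Type*} [Field F] (q B T E0 E1 : F) :
    colF q B T E0 E1
      = colF q B T 1 0 * E0
      + colF q B T 0 1 * E1 := by
  simp only [colF]
  ring

theorem map_colF {F : Type*} [Field F] [Algebra L F] (q B T E0 E1 : L) :
    algebraMap L F (colF q B T E0 E1)
      = colF (algebraMap L F q) (algebraMap L F B) (algebraMap L F T)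
        (algebraMap L F E0) (algebraMap L F E1) := by
  simp [colF, qn]

theorem colF_ePositive (h1 : q ≠ 1) {b t m : ℕ} (h : b + t = m + 1) :
    EPositive q x (m + 2) fun N => colF (algebraMap L (A N) q) (algebraMap L (A N) q ^ b) (algebraMap L (A N) q ^ t)
      (elem (x N) (m + 2))
      (elem (x N) (m + 1) * elem (x N) 1) := by
  obtain ⟨c0, c1⟩ := colF_mem h1 h
  have := ((EPositive.single (x := x) (n := m + 2) {m + 2} (by simp) c0).add
    (EPositive.single (x := x) (n := m + 2) {m + 1, 1} (by simp) c1))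
  convert this using 2 with N
  rw [colF_linear]
  simp [map_colF]

theorem colsF_linear {F : Type*} [Field F] (q J K S E0 E1 E2 : F) :
    colsF q J K S E0 E1 E2
      = colsF q J K S 1 0 0 * E0
      + colsF q J K S 0 1 0 * E1
      + colsF q J K S 0 0 1 * E2 := by
  simp only [colsF]
  ring

theorem map_colsF {F : Type*} [Field F] [Algebra L F] (q J K S E0 E1 E2 : L) :
    algebraMap L F (colsF q J K S E0 E1 E2)
      = colsF (algebraMap L F q) (algebraMap L F J) (algebraMap L F K) (algebraMap L F S)
        (algebraMap L F E0) (algebraMap L F E1) (algebraMap L F E2) := by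
  simp [colsF, qn]

theorem colsF_ePositive (h0 : q ≠ 0) (h1 : q ≠ 1) {j k s m : ℕ} (h : j + k + s = m + 2) :
    EPositive q x (m + 4) fun N => colsF (algebraMap L (A N) q) (algebraMap L (A N) q ^ j) (algebraMap L (A N) q ^ k) (algebraMap L (A N) q ^ s)
      (elem (x N) (m + 4))
      (elem (x N) (m + 3) * elem (x N) 1)
      (elem (x N) (m + 2) * elem (x N) 2) := by
  obtain ⟨c0, c1, c2⟩ := colsF_mem h0 h1 h
  have := (((EPositive.single (x := x) (n := m + 4) {m + 4} (by simp) c0).add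
    (EPositive.single (x := x) (n := m + 4) {m + 3, 1} (by simp) c1)).add
    (EPositive.single (x := x) (n := m + 4) {m + 2, 2} (by simp) c2))
  convert this using 2 with N
  rw [colsF_linear]
  simp [map_colsF]

theorem hookLowF_linear {F : Type*} [Field F] (q P T K E0 E1 E2 E3 : F) :
    hookLowF q P T K E0 E1 E2 E3
      = hookLowF q P T K 1 0 0 0 * E0
      + hookLowF q P T K 0 1 0 0 * E1
      + hookLowF q P T K 0 0 1 0 * E2
      + hookLowF q P T K 0 0 0 1 * E3 := by
  simp only [hookLowF]
  ring

theorem map_hookLowF {F : Type*} [Field F] [Algebra L F] (q P T K E0 E1 E2 E3 : L) :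
    algebraMap L F (hookLowF q P T K E0 E1 E2 E3)
      = hookLowF (algebraMap L F q) (algebraMap L F P) (algebraMap L F T) (algebraMap L F K)
        (algebraMap L F E0) (algebraMap L F E1) (algebraMap L F E2) (algebraMap L F E3) := by
  simp [hookLowF, qn]

theorem hookLowF_ePositive (h0 : q ≠ 0) (h1 : q ≠ 1) {p t k m : ℕ} (h : p + k + t = m + 2) (hp1 : 1 ≤ p) :
    EPositive q x (m + 4) fun N => hookLowF (algebraMap L (A N) q) (algebraMap L (A N) q ^ p) (algebraMap L (A N) q ^ t) (algebraMap L (A N) q ^ k)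
      (elem (x N) (m + 4))
      (elem (x N) (m + 3) * elem (x N) 1)
      (elem (x N) (m + 2) * elem (x N) 2)
      (elem (x N) (m + 2) * elem (x N) 1 ^ 2) := by
  obtain ⟨c0, c1, c2, c3⟩ := hookLowF_mem h0 h1 h hp1
  have := ((((EPositive.single (x := x) (n := m + 4) {m + 4} (by simp) c0).add
    (EPositive.single (x := x) (n := m + 4) {m + 3, 1} (by simp) c1)).add
    (EPositive.single (x := x) (n := m + 4) {m + 2, 2} (by simp) c2)).add
    (EPositive.single (x := x) (n := m + 4) {m + 2, 1, 1} (by simp) c3))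
  convert this using 2 with N
  rw [hookLowF_linear]
  simp [map_hookLowF, pow_two]

theorem hookHighF_linear {F : Type*} [Field F] (q I J K E0 E1 E2 : F) :
    hookHighF q I J K E0 E1 E2
      = hookHighF q I J K 1 0 0 * E0
      + hookHighF q I J K 0 1 0 * E1
      + hookHighF q I J K 0 0 1 * E2 := by
  simp only [hookHighF]
  ring

theorem map_hookHighF {F : Type*} [Field F] [Algebra L F] (q I J K E0 E1 E2 : L) :
    algebraMap L F (hookHighF q I J K E0 E1 E2)
      = hookHighF (algebraMap L F q) (algebraMap L F I) (algebraMap L F J) (algebraMap L F K)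
        (algebraMap L F E0) (algebraMap L F E1) (algebraMap L F E2) := by
  simp [hookHighF, qn]

theorem hookHighF_ePositive (h0 : q ≠ 0) (h1 : q ≠ 1) {i j k m : ℕ} (h : i + j + k = m + 2) (hk : 1 ≤ k) :
    EPositive q x (m + 4) fun N => hookHighF (algebraMap L (A N) q) (algebraMap L (A N) q ^ i) (algebraMap L (A N) q ^ j) (algebraMap L (A N) q ^ k)
      (elem (x N) (m + 4))
      (elem (x N) (m + 3) * elem (x N) 1)
      (elem (x N) (m + 2) * elem (x N) 2) := by
  obtain ⟨c0, c1, c2⟩ := hookHighF_mem h0 h1 h hk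
  have := (((EPositive.single (x := x) (n := m + 4) {m + 4} (by simp) c0).add
    (EPositive.single (x := x) (n := m + 4) {m + 3, 1} (by simp) c1)).add
    (EPositive.single (x := x) (n := m + 4) {m + 2, 2} (by simp) c2))
  convert this using 2 with N
  rw [hookHighF_linear]
  simp [map_hookHighF]

theorem cornerF_linear {F : Type*} [Field F] (q M E0 E1 E2 E3 E4 : F) :
    cornerF q M E0 E1 E2 E3 E4
      = cornerF q M 1 0 0 0 0 * E0
      + cornerF q M 0 1 0 0 0 * E1
      + cornerF q M 0 0 1 0 0 * E2
      + cornerF q M 0 0 0 1 0 * E3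
      + cornerF q M 0 0 0 0 1 * E4 := by
  simp only [cornerF]
  ring

theorem map_cornerF {F : Type*} [Field F] [Algebra L F] (q M E0 E1 E2 E3 E4 : L) :
    algebraMap L F (cornerF q M E0 E1 E2 E3 E4)
      = cornerF (algebraMap L F q) (algebraMap L F M)
        (algebraMap L F E0) (algebraMap L F E1) (algebraMap L F E2) (algebraMap L F E3) (algebraMap L F E4) := by
  simp [cornerF, qn]

theorem cornerF_ePositive (h0 : q ≠ 0) (h1 : q ≠ 1) (m : ℕ)  :
    EPositive q x (m + 5) fun N => cornerF (algebraMap L (A N) q) (algebraMap L (A N) q ^ (m + 2))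
      (elem (x N) (m + 5))
      (elem (x N) (m + 4) * elem (x N) 1)
      (elem (x N) (m + 3) * elem (x N) 2)
      (elem (x N) (m + 2) * elem (x N) 3)
      (elem (x N) (m + 2) * elem (x N) 2 * elem (x N) 1) := by
  obtain ⟨c0, c1, c2, c3, c4⟩ := cornerF_mem h0 h1 (m := m)
  have := (((((EPositive.single (x := x) (n := m + 5) {m + 5} (by simp) c0).add
    (EPositive.single (x := x) (n := m + 5) {m + 4, 1} (by simp) c1)).add
    (EPositive.single (x := x) (n := m + 5) {m + 3, 2} (by simp) c2)).add
    (EPositive.single (x := x) (n := m + 5) {m + 2, 3} (by simp) c3)).add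
    (EPositive.single (x := x) (n := m + 5) {m + 2, 2, 1} (by simp) c4))
  convert this using 2 with N
  rw [cornerF_linear]
  simp [map_cornerF, mul_assoc]

theorem hookAF_linear {F : Type*} [Field F] (q P J K S E0 E1 E2 E3 E4 E5 : F) :
    hookAF q P J K S E0 E1 E2 E3 E4 E5
      = hookAF q P J K S 1 0 0 0 0 0 * E0
      + hookAF q P J K S 0 1 0 0 0 0 * E1
      + hookAF q P J K S 0 0 1 0 0 0 * E2
      + hookAF q P J K S 0 0 0 1 0 0 * E3
      + hookAF q P J K S 0 0 0 0 1 0 * E4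
      + hookAF q P J K S 0 0 0 0 0 1 * E5 := by
  simp only [hookAF, hookCoeff]
  ring

theorem map_hookAF {F : Type*} [Field F] [Algebra L F] (q P J K S E0 E1 E2 E3 E4 E5 : L) :
    algebraMap L F (hookAF q P J K S E0 E1 E2 E3 E4 E5)
      = hookAF (algebraMap L F q) (algebraMap L F P) (algebraMap L F J) (algebraMap L F K) (algebraMap L F S)
        (algebraMap L F E0) (algebraMap L F E1) (algebraMap L F E2) (algebraMap L F E3) (algebraMap L F E4) (algebraMap L F E5) := by
  simp [hookAF, hookCoeff, qn]

theorem hookAF_ePositive (h0 : q ≠ 0) (h1 : q ≠ 1) {p j k s m : ℕ} (h : p + j + k + s = m + 3) (hp1 : 1 ≤ p)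
    (hj : 1 ≤ j) (hks : 1 ≤ k + s) :
    EPositive q x (m + 6) fun N => hookAF (algebraMap L (A N) q) (algebraMap L (A N) q ^ p) (algebraMap L (A N) q ^ j) (algebraMap L (A N) q ^ k) (algebraMap L (A N) q ^ s)
      (elem (x N) (m + 6))
      (elem (x N) (m + 5) * elem (x N) 1)
      (elem (x N) (m + 4) * elem (x N) 2)
      (elem (x N) (m + 4) * elem (x N) 1 ^ 2)
      (elem (x N) (m + 3) * elem (x N) 3)
      (elem (x N) (m + 3) * elem (x N) 2 * elem (x N) 1) := by
  obtain ⟨c0, c1, c2, c3, c4, c5⟩ := hookAF_mem h0 h1 h hp1 hj hks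
  have := ((((((EPositive.single (x := x) (n := m + 6) {m + 6} (by simp) c0).add
    (EPositive.single (x := x) (n := m + 6) {m + 5, 1} (by simp) c1)).add
    (EPositive.single (x := x) (n := m + 6) {m + 4, 2} (by simp) c2)).add
    (EPositive.single (x := x) (n := m + 6) {m + 4, 1, 1} (by simp) c3)).add
    (EPositive.single (x := x) (n := m + 6) {m + 3, 3} (by simp) c4)).add
    (EPositive.single (x := x) (n := m + 6) {m + 3, 2, 1} (by simp) c5))
  convert this using 2 with N
  rw [hookAF_linear]
  simp [map_hookAF, pow_two, mul_assoc]

theorem hookBF_linear {F : Type*} [Field F] (q I J K S E0 E1 E2 E3 E4 E5 : F) :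
    hookBF q I J K S E0 E1 E2 E3 E4 E5
      = hookBF q I J K S 1 0 0 0 0 0 * E0
      + hookBF q I J K S 0 1 0 0 0 0 * E1
      + hookBF q I J K S 0 0 1 0 0 0 * E2
      + hookBF q I J K S 0 0 0 1 0 0 * E3
      + hookBF q I J K S 0 0 0 0 1 0 * E4
      + hookBF q I J K S 0 0 0 0 0 1 * E5 := by
  simp only [hookBF, hookCoeff]
  ring

theorem map_hookBF {F : Type*} [Field F] [Algebra L F] (q I J K S E0 E1 E2 E3 E4 E5 : L) :
    algebraMap L F (hookBF q I J K S E0 E1 E2 E3 E4 E5)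
      = hookBF (algebraMap L F q) (algebraMap L F I) (algebraMap L F J) (algebraMap L F K) (algebraMap L F S)
        (algebraMap L F E0) (algebraMap L F E1) (algebraMap L F E2) (algebraMap L F E3) (algebraMap L F E4) (algebraMap L F E5) := by
  simp [hookBF, hookCoeff, qn]

theorem hookBF_ePositive (h0 : q ≠ 0) (h1 : q ≠ 1) {i j k s m : ℕ} (h : i + j + k + s = m + 3) (hi : 1 ≤ i)
    (hk : 1 ≤ k) :
    EPositive q x (m + 6) fun N => hookBF (algebraMap L (A N) q) (algebraMap L (A N) q ^ i) (algebraMap L (A N) q ^ j) (algebraMap L (A N) q ^ k) (algebraMap L (A N) q ^ s)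
      (elem (x N) (m + 6))
      (elem (x N) (m + 5) * elem (x N) 1)
      (elem (x N) (m + 4) * elem (x N) 2)
      (elem (x N) (m + 4) * elem (x N) 1 ^ 2)
      (elem (x N) (m + 3) * elem (x N) 3)
      (elem (x N) (m + 3) * elem (x N) 2 * elem (x N) 1) := by
  obtain ⟨c0, c1, c2, c3, c4, c5⟩ := hookBF_mem h0 h1 h hi hk
  have := ((((((EPositive.single (x := x) (n := m + 6) {m + 6} (by simp) c0).add
    (EPositive.single (x := x) (n := m + 6) {m + 5, 1} (by simp) c1)).add
    (EPositive.single (x := x) (n := m + 6) {m + 4, 2} (by simp) c2)).add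
    (EPositive.single (x := x) (n := m + 6) {m + 4, 1, 1} (by simp) c3)).add
    (EPositive.single (x := x) (n := m + 6) {m + 3, 3} (by simp) c4)).add
    (EPositive.single (x := x) (n := m + 6) {m + 3, 2, 1} (by simp) c5))
  convert this using 2 with N
  rw [hookBF_linear]
  simp [map_hookBF, pow_two, mul_assoc]

end ClosedForms

section Families

variable {L : Type} [Field L] {A : ℕ → Type} [∀ N, Field (A N)] [∀ N, CharZero (A N)]
  [∀ N, Algebra L (A N)] {q : L} {x : ∀ N, Fin N → A N}

theorem colX_ePositive (h0 : q ≠ 0) (hq : ∀ k, 0 < k → q ^ k ≠ 1) {n b : ℕ} (h : b + 1 ≤ n)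
    (hn : 2 ≤ n) : EPositive q x n fun N => colX (algebraMap L (A N) q) (x N) n b := by
  have h1 : q ≠ 1 := by simpa using hq 1 one_pos
  have h0' (N : ℕ) : algebraMap L (A N) q ≠ 0 := by simpa using h0
  have hq' (N : ℕ) : ∀ k, 0 < k → algebraMap L (A N) q ^ k ≠ 1 := fun k hk => by
    simpa [← map_pow] using hq k hk
  obtain ⟨m, rfl⟩ := Nat.exists_eq_add_of_le' hn
  have e : b + (m + 1 - b) = m + 1 := by omega
  simpa only [colX_eq _ (h0' _) (hq' _) e] using (colF_ePositive h1 e).fac_mul m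

theorem rowX_ePositive (h0 : q ≠ 0) (hq : ∀ k, 0 < k → q ^ k ≠ 1) {n c : ℕ} (hc : 1 ≤ c)
    (h : c ≤ n) (hn : 2 ≤ n) :
    EPositive q x n fun N => rowX (algebraMap L (A N) q) (x N) n c := by
  have h1 : q ≠ 1 := by simpa using hq 1 one_pos
  have h0' (N : ℕ) : algebraMap L (A N) q ≠ 0 := by simpa using h0
  have hq' (N : ℕ) : ∀ k, 0 < k → algebraMap L (A N) q ^ k ≠ 1 := fun k hk => by
    simpa [← map_pow] using hq k hk
  obtain ⟨m, rfl⟩ := Nat.exists_eq_add_of_le' hn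
  obtain ⟨p, rfl⟩ := Nat.exists_eq_add_of_le' hc
  have e : p + (m + 1 - p) = m + 1 := by omega
  have e' : (m + 1 - p) + p = m + 1 := by omega
  simpa only [rowX_eq _ (h0' _) (hq' _) e] using (colF_ePositive h1 e').fac_mul m

/-- The graphs with `c < a ≤ b ≤ n - 2`. -/
theorem hookX_ePositive_of_lt (h0 : q ≠ 0) (hq : ∀ k, 0 < k → q ^ k ≠ 1) {n c a b : ℕ}
    (hc : 1 ≤ c) (hca : c < a) (hab : a ≤ b) (hb : b + 2 ≤ n) :
    EPositive q x n fun N => hookX (algebraMap L (A N) q) (x N) n c a b := by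
  have h1 : q ≠ 1 := by simpa using hq 1 one_pos
  have h0' (N : ℕ) : algebraMap L (A N) q ≠ 0 := by simpa using h0
  have hq' (N : ℕ) : ∀ k, 0 < k → algebraMap L (A N) q ^ k ≠ 1 := fun k hk => by
    simpa [← map_pow] using hq k hk
  rcases Nat.lt_or_ge n (a + 3) with ha | ha
  · obtain rfl : n = a + 2 := by omega
    obtain rfl : b = a := by omega
    have := ((rowX_ePositive (x := x) h0 hq hc hca.le (by omega)).elem_mul 2).fac_mul 2
    rw [add_comm b 2]
    convert this using 2 with N
    rw [add_comm, hookX_split_two _ _ hca.le, fullX]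
    ring
  rcases Nat.lt_or_ge c 2 with hc2 | hc2
  · obtain rfl : c = 1 := by omega
    obtain ⟨m, rfl⟩ := Nat.exists_eq_add_of_le' (show 5 ≤ n by omega)
    obtain ⟨j, rfl⟩ := Nat.exists_eq_add_of_le' (show 1 ≤ a by omega)
    obtain ⟨k, rfl⟩ := Nat.exists_eq_add_of_le hab
    have e : j + k + (m + 2 - j - k) = m + 2 := by omega
    have := ((colsF_ePositive (x := x) h0 h1 e).fac_mul m).elem_mul 1
    rw [show 1 + (m + 4) = m + 5 by omega] at this
    convert this using 2 with N
    rw [show j + 1 + k = j + k + 1 by omega, ← colsX_eq _ (h0' _) (hq' _) e]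
    exact hookX_one_left _ _ (by omega)
  · obtain ⟨m, rfl⟩ := Nat.exists_eq_add_of_le' (show 6 ≤ n by omega)
    obtain ⟨p, rfl⟩ := Nat.exists_eq_add_of_le' hc
    obtain ⟨j, rfl⟩ := Nat.exists_eq_add_of_le hca.le
    obtain ⟨k, rfl⟩ := Nat.exists_eq_add_of_le hab
    have e : p + j + k + (m + 3 - p - j - k) = m + 3 := by omega
    have := (hookAF_ePositive (x := x) h0 h1 e (by omega) (by omega) (by omega)).fac_mul m
    convert this using 2 with N
    rw [show p + 1 + j + k = p + j + k + 1 by omega, show p + 1 + j = p + j + 1 by omega,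
      hookX_valA _ (h0' _) (hq' _) e]
    rfl

/-- The graphs with `a ≤ c < b ≤ n - 1`. -/
theorem hookX_ePositive_of_le (h0 : q ≠ 0) (hq : ∀ k, 0 < k → q ^ k ≠ 1) {n c a b : ℕ}
    (ha : 1 ≤ a) (hac : a ≤ c) (hcb : c < b) (hb : b + 1 ≤ n) (hcn : c + 2 ≤ n) :
    EPositive q x n fun N => hookX (algebraMap L (A N) q) (x N) n c a b := by
  have h1 : q ≠ 1 := by simpa using hq 1 one_pos
  have h0' (N : ℕ) : algebraMap L (A N) q ≠ 0 := by simpa using h0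
  have hq' (N : ℕ) : ∀ k, 0 < k → algebraMap L (A N) q ^ k ≠ 1 := fun k hk => by
    simpa [← map_pow] using hq k hk
  obtain ⟨n, rfl⟩ := Nat.exists_eq_add_of_le' (show 1 ≤ n by omega)
  by_cases hfull : b = n ∧ c + 1 = n
  · obtain ⟨rfl, rfl⟩ := hfull
    have := (colX_ePositive (x := x) h0 hq (n := c + 1) (b := a) (by omega) (by omega)).elem_mul 1
    rw [add_comm 1] at this
    convert this using 2 with N
    rw [mul_comm]
    exact hookX_last_right_full _ _ (by omega)
  rcases Nat.lt_or_ge c 2 with hc2 | hc2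
  · obtain rfl : c = 1 := by omega
    obtain rfl : a = 1 := by omega
    obtain ⟨b, rfl⟩ := Nat.exists_eq_add_of_le' (show 1 ≤ b by omega)
    obtain ⟨m, rfl⟩ := Nat.exists_eq_add_of_le' (show 3 ≤ n by omega)
    have := (colX_ePositive (x := x) h0 hq (n := m + 3) (b := b) (by omega) (by omega)).elem_mul 1
    rw [add_comm 1] at this
    convert this using 2 with N
    rw [← hookX_zero_left]
    exact hookX_one_left _ _ (by omega)
  rcases eq_or_lt_of_le (show b ≤ n by omega) with rfl | hbn
  · obtain ⟨m, rfl⟩ := Nat.exists_eq_add_of_le' (show 4 ≤ b by omega)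
    obtain ⟨i, rfl⟩ := Nat.exists_eq_add_of_le' ha
    obtain ⟨j, rfl⟩ := Nat.exists_eq_add_of_le hac
    have e : i + j + (m + 2 - i - j) = m + 2 := by omega
    have := ((hookHighF_ePositive (x := x) h0 h1 e (by omega)).fac_mul m).elem_mul 1
    rw [add_comm 1] at this
    convert this using 2 with N
    rw [show i + 1 + j = i + j + 1 by omega, hookX_last_right' _ _ (by omega),
      hookHigh_eq _ (h0' _) (hq' _) e (by omega) (by omega), mul_comm]
  rcases Nat.lt_or_ge a 2 with ha2 | ha2
  · obtain rfl : a = 1 := by omega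
    obtain ⟨m, rfl⟩ := Nat.exists_eq_add_of_le' (show 3 ≤ n by omega)
    obtain ⟨p, rfl⟩ := Nat.exists_eq_add_of_le' hac
    obtain ⟨k, rfl⟩ := Nat.exists_eq_add_of_le hcb.le
    have e : p + k + (m + 2 - p - k) = m + 2 := by omega
    simpa only [hookLow_eq _ (h0' _) (hq' _) e (show 1 ≤ m + 2 - p - k by omega)] using
      (hookLowF_ePositive (x := x) h0 h1 e (by omega)).fac_mul m
  rcases Nat.lt_or_ge n 5 with hn | hn
  · obtain ⟨rfl, rfl, rfl, rfl⟩ : n = 4 ∧ c = 2 ∧ a = 2 ∧ b = 3 := by omega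
    simpa only [corner_eq _ (h0' _) (hq' _) 0] using
      (cornerF_ePositive (x := x) h0 h1 0).fac_mul 0
  obtain ⟨m, rfl⟩ := Nat.exists_eq_add_of_le' hn
  obtain ⟨i, rfl⟩ := Nat.exists_eq_add_of_le' ha
  obtain ⟨j, rfl⟩ := Nat.exists_eq_add_of_le hac
  obtain ⟨k, rfl⟩ := Nat.exists_eq_add_of_le hcb.le
  have e : i + j + k + (m + 3 - i - j - k) = m + 3 := by omega
  have := (hookBF_ePositive (x := x) h0 h1 e (by omega) (by omega)).fac_mul m
  convert this using 2 with N
  rw [show i + 1 + j + k = i + j + k + 1 by omega, show i + 1 + j = i + j + 1 by omega,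
    hookX_valB _ (h0' _) (hq' _) e (by omega) (by omega)]
  rfl

end Families

open Polynomial in
theorem map_Xq {F : Type*} [Field F] {n N : ℕ} (D : DyckPath n)
    (φ : MvPolynomial (Fin N) ℤ[X] →+* F) {β : ℕ → ℕ}
    (hβ : ∀ u v, u < v → v < n → (D.Incomp (u + 1) (v + 1) ↔ β v ≤ u)) :
    φ (D.Xq N) = chi (φ (MvPolynomial.C X)) (fun i => φ (MvPolynomial.X i)) n β := by
  rw [chi_eq_sum, DyckPath.Xq, Finset.sum_filter, map_sum]
  refine Finset.sum_congr rfl fun κ _ => ?_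
  rw [← Fintype.prod_prod_type' fun i j : Fin n => if i.1 < j.1 ∧ β j.1 ≤ i.1 then
    edgeWt (φ (MvPolynomial.C X)) (κ i) (κ j) else 1]
  split_ifs with h
  · rw [map_mul, map_pow, map_pow, map_prod, DyckPath.ascNum, ← Finset.prod_const,
      Finset.prod_filter]
    congr 1
    refine Finset.prod_congr rfl fun p _ => ?_
    by_cases hp : p.1.1 < p.2.1 ∧ β p.2.1 ≤ p.1.1
    · have hi := (hβ _ _ hp.1 p.2.2).2 hp.2
      rw [if_pos hp]
      rcases lt_trichotomy (κ p.1) (κ p.2) with hk | hk | hk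
      · rw [edgeWt_of_lt _ hk, if_pos ⟨hp.1, hi, hk⟩]
      · exact absurd hk (h _ _ hi (Fin.ne_of_lt hp.1))
      · rw [edgeWt_of_gt _ hk, if_neg fun h' => lt_asymm hk h'.2.2]
    · rw [if_neg hp, if_neg fun h' => hp ⟨h'.1, (hβ _ _ h'.1 p.2.2).1 h'.2.1⟩]
  · have : ∃ u v : Fin n, u < v ∧ D.Incomp (u.1 + 1) (v.1 + 1) ∧ κ u = κ v := by
      simp only [DyckPath.IsProperColoring, not_forall, not_not] at h
      obtain ⟨u, v, hi, hne, hk⟩ := h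
      rcases lt_or_gt_of_ne hne with huv | huv
      exacts [⟨u, v, huv, hi, hk⟩, ⟨v, u, huv, ⟨hi.2, hi.1⟩, hk.symm⟩]
    obtain ⟨u, v, huv, hi, hk⟩ := this
    rw [map_zero, Finset.prod_eq_zero (Finset.mem_univ (u, v)), zero_mul]
    rw [if_pos ⟨huv, (hβ _ _ huv v.2).1 hi⟩, hk, edgeWt_self]

theorem map_esymm {F R : Type*} [Field F] [CommRing R] {N : ℕ} (φ : MvPolynomial (Fin N) R →+* F)
    (r : ℕ) : φ (MvPolynomial.esymm (Fin N) R r) = elem (fun i => φ (MvPolynomial.X i)) r := by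
  simp [MvPolynomial.esymm, elem, map_sum, map_prod]

/-- The vertices whose reach is at most `t` form an initial segment. -/
theorem exists_le_iff {n : ℕ} (D : DyckPath n) (t : ℕ) :
    ∃ a, a ≤ n - 1 ∧ ∀ i, 1 ≤ i → i < n → (D.d i ≤ t ↔ i ≤ a) := by
  let P : ℕ → Prop := fun i => 1 ≤ i ∧ D.d i ≤ t
  refine ⟨Nat.findGreatest P (n - 1), Nat.findGreatest_le _, fun i hi hn =>
    ⟨fun h => Nat.le_findGreatest (P := P) (by omega) ⟨hi, h⟩, fun h => ?_⟩⟩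
  have hP : P (Nat.findGreatest P (n - 1)) := Nat.findGreatest_of_ne_zero rfl (by omega)
  have hl : Nat.findGreatest P (n - 1) ≤ n - 1 := Nat.findGreatest_le _
  exact (D.mono _ _ hi h (by omega)).trans hP.2

theorem incomp_iff {n : ℕ} (D : DyckPath n) {u v : ℕ} (huv : u < v) (hv : v < n) :
    D.Incomp (u + 1) (v + 1) ↔ v + 1 ≤ D.d (u + 1) := by
  have := D.ge_self (v + 1) (by omega) hv
  simp only [DyckPath.Incomp, DyckPath.prec]
  omega

theorem exists_hook {n : ℕ} (D : DyckPath n)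
    (hform : ∀ i : ℕ, 2 ≤ i → i < n → D.d i = n - 2 ∨ D.d i = n - 1 ∨ D.d i = n)
    (h3 : D.BounceThree) :
    ∃ c a b, (1 ≤ c ∧ c < a ∧ a ≤ b ∧ b + 2 ≤ n ∨
        1 ≤ a ∧ a ≤ c ∧ c < b ∧ b + 1 ≤ n ∧ c + 2 ≤ n) ∧
      ∀ u v, u < v → v < n → (D.Incomp (u + 1) (v + 1) ↔ hookThreshold n c a b v ≤ u) := by
  obtain ⟨h0, h1, h2⟩ := h3
  simp only [DyckPath.m0, DyckPath.m1, DyckPath.bounce] at h0 h1 h2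
  have hc1 : 1 ≤ D.d 1 := D.ge_self 1 le_rfl (by omega)
  have hcn : D.d 1 + 2 ≤ n := by
    by_contra h
    have e : D.d 1 + 1 = n := by omega
    rw [e, D.top] at h1
    exact lt_irrefl _ h1
  obtain ⟨a, ha, hai⟩ := exists_le_iff D (n - 2)
  obtain ⟨b, hb, hbi⟩ := exists_le_iff D (n - 1)
  have ha1 : 1 ≤ a := (hai 1 le_rfl (by omega)).1 (by omega)
  have hab : a ≤ b := (hbi a ha1 (by omega)).1 (by
    have := (hai a ha1 (by omega)).2 le_rfl
    omega)
  have hac := hai (D.d 1 + 1) (by omega) (by omega)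
  have hbc := hbi (D.d 1 + 1) (by omega) (by omega)
  refine ⟨D.d 1, a, b, ?_, fun u v huv hv => ?_⟩
  · rcases hform (D.d 1 + 1) (by omega) (by omega) with e | e | e
    · left
      rw [e, show n - 2 + 1 = n - 1 by omega] at h2
      have := hbi (n - 1) (by omega) (by omega)
      omega
    · right
      omega
    · omega
  · rw [incomp_iff D huv hv, hookThreshold]
    have hA := hai (u + 1) (by omega) (by omega)
    have hB := hbi (u + 1) (by omega) (by omega)
    have hle := D.le_n (u + 1) (by omega) (by omega)
    rcases Nat.eq_zero_or_pos u with rfl | hu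
    · simp only [zero_add] at *
      split_ifs <;> omega
    · have := hform (u + 1) (by omega) (by omega)
      split_ifs <;> omega

open Polynomial in
/-- The inclusion of `ℤ[q][x₁, …, x_N]` into the field of rational functions in `x` over `ℚ(q)`. -/
noncomputable def toRational (N : ℕ) :
    MvPolynomial (Fin N) ℤ[X] →+* FractionRing (MvPolynomial (Fin N) (FractionRing ℤ[X])) :=
  (algebraMap (MvPolynomial (Fin N) (FractionRing ℤ[X])) _).comp
    (MvPolynomial.map (algebraMap ℤ[X] (FractionRing ℤ[X])))

theorem toRational_injective (N : ℕ) : Function.Injective (toRational N) := by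
  rw [toRational, RingHom.coe_comp]
  exact (IsFractionRing.injective _ _).comp
    (MvPolynomial.map_injective _ (IsFractionRing.injective _ _))

open Polynomial in
theorem toRational_C (N : ℕ) (r : ℤ[X]) : toRational N (MvPolynomial.C r) =
    algebraMap (FractionRing ℤ[X]) _ (algebraMap ℤ[X] (FractionRing ℤ[X]) r) := by
  rw [toRational, RingHom.comp_apply, MvPolynomial.map_C, ← MvPolynomial.algebraMap_eq,
    ← IsScalarTower.algebraMap_apply]

end ChromaticQuasi

open ChromaticQuasi

/-- **Corollary `Corepos`.** For a Dyck path
`d = (d₁, n-2, …, n-2, n-1, …, n-1, n, …, n)` of bounce number three,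
`X_{inc(P(d))}(x, q)` is `e`-positive: there are polynomials `c_λ(q) ∈ ℕ[q]` indexed by
partitions `λ ⊢ n` such that for every `N ≥ n`,
`X_G(x₁,…,x_N; q) = Σ_{λ ⊢ n} c_λ(q) · e_{λ₁} ⋯ e_{λ_ℓ}`. -/
theorem Xq_e_positive_transpose_family
    (n : ℕ) (D : DyckPath n)
    (hform : ∀ i : ℕ, 2 ≤ i → i < n → D.d i = n - 2 ∨ D.d i = n - 1 ∨ D.d i = n)
    (h3 : D.BounceThree) :
    ∃ c : Nat.Partition n → Polynomial ℕ,
      ∀ N : ℕ, n ≤ N →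
        D.Xq N = ∑ P : Nat.Partition n,
          MvPolynomial.C ((c P).map (Nat.castRingHom ℤ)) *
            (P.parts.map fun r => MvPolynomial.esymm (Fin N) (Polynomial ℤ) r).prod := by
  let L := FractionRing (Polynomial ℤ)
  let q : L := algebraMap (Polynomial ℤ) L Polynomial.X
  have hinj : Function.Injective (algebraMap (Polynomial ℤ) L) := IsFractionRing.injective _ _
  have h0 : q ≠ 0 := (map_ne_zero_iff _ hinj).2 Polynomial.X_ne_zero
  have hq : ∀ k, 0 < k → q ^ k ≠ 1 := fun k hk h => by
    rw [← map_pow, ← map_one (algebraMap (Polynomial ℤ) L)] at h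
    have := congrArg Polynomial.natDegree (hinj h)
    simp at this
    omega
  have : ∀ N, CharZero (FractionRing (MvPolynomial (Fin N) L)) := fun N =>
    charZero_of_injective_algebraMap (R := L) (algebraMap L _).injective
  obtain ⟨c, a, b, hcab, hβ⟩ := exists_hook D hform h3
  have key : EPositive (A := fun N => FractionRing (MvPolynomial (Fin N) L)) q
      (fun N i => toRational N (MvPolynomial.X i)) n fun N => hookX (algebraMap L _ q)
        (fun i => toRational N (MvPolynomial.X i)) n c a b := by
    rcases hcab with ⟨h1, h2, h4, h5⟩ | ⟨h1, h2, h4, h5, h6⟩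
    exacts [hookX_ePositive_of_lt h0 hq h1 h2 h4 h5, hookX_ePositive_of_le h0 hq h1 h2 h4 h5 h6]
  obtain ⟨w, hw, e⟩ := key
  choose p hp using hw
  refine ⟨p, fun N _ => toRational_injective N ?_⟩
  rw [map_Xq D _ hβ, toRational_C]
  refine (e N).trans ?_
  rw [map_sum]
  refine Finset.sum_congr rfl fun P _ => ?_
  rw [map_mul, map_multiset_prod, Multiset.map_map, toRational_C]
  congr 2
  · rw [← hp P, ← Polynomial.coe_mapRingHom, ← RingHom.comp_apply]
    congr 1
    refine Polynomial.ringHom_ext' (Subsingleton.elim _ _) ?_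
    rw [Polynomial.coe_eval₂RingHom, Polynomial.eval₂_X, RingHom.comp_apply,
      Polynomial.coe_mapRingHom, Polynomial.map_X]
  · exact Multiset.map_congr rfl fun r _ => (map_esymm _ r).symm
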